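/- For every integer n ≥ 1 there exists a bijection φ from the set of increasing 1,2-trees on {1,…,n} to the set of Cayley trees on {1,…,n} with the following properties: (i) for every increasing 1,2-tree G, the number of edges of G equals (n−1) plus the number of twists of φ(G); (ii) if G is a tree (i.e., G has exactly n−1 edges), then φ(G) = G; (iii) if n ≥ 2 and G has exactly 2n−3 edges (G is an increasing 2-tree), then vertex 1 has exactly one incident edge in φ(G), that edge is increasing, and every other edge of φ(G) is a twist. -/

import Mathlib

open SimpleGraph

/-- The set of neighbors of `v` having a smaller label. -/
def lowerNbrs {n : ℕ} (G : SimpleGraph (Fin n)) (v : Fin n) : Set (Fin n) :=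
  {x | G.Adj v x ∧ x < v}

/-- `G` is an increasing 1,2-tree: every vertex other than the first one has a nonempty
set of smaller neighbors, of cardinality at most 2, forming a clique. -/
def IsIncreasing12Tree {n : ℕ} (G : SimpleGraph (Fin n)) : Prop :=
  ∀ v : Fin n, 1 ≤ v.val →
    (lowerNbrs G v).Nonempty ∧ (lowerNbrs G v).ncard ≤ 2 ∧
      ∀ x ∈ lowerNbrs G v, ∀ y ∈ lowerNbrs G v, x ≠ y → G.Adj x y

/-- The set of vertices reachable from `v` after deleting the edge `{u,v}`
(in a tree, the vertex set of the subtree rooted at `v` when `v` is the child endpoint). -/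
def subtreeSet {n : ℕ} (G : SimpleGraph (Fin n)) (u v : Fin n) : Set (Fin n) :=
  {w | (G.deleteEdges {s(u, v)}).Reachable v w}

/-- `v` is the child endpoint of the edge `{u,v}`: after deleting this edge,
`v` is no longer reachable from the root. -/
def IsChild {n : ℕ} (G : SimpleGraph (Fin n)) (root u v : Fin n) : Prop :=
  G.Adj u v ∧ ¬ (G.deleteEdges {s(u, v)}).Reachable root v

/-- The minimal label occurring in a set of vertices (labels being `Fin.val`). -/
noncomputable def minLabel {n : ℕ} (S : Set (Fin n)) : ℕ := sInf (Fin.val '' S)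

/-- An edge `{u,v}` with child endpoint `v` is a twist if the minimal label in the
subtree rooted at `v` is smaller than the label of `u`. -/
def IsTwist {n : ℕ} (G : SimpleGraph (Fin n)) (root : Fin n) (e : Sym2 (Fin n)) : Prop :=
  ∃ u v : Fin n, e = s(u, v) ∧ IsChild G root u v ∧ minLabel (subtreeSet G u v) < u.val

/-- An edge `{u,v}` with child endpoint `v` is increasing if the label of `u` is smaller
than every label in the subtree rooted at `v`. -/
def IsIncreasingEdge {n : ℕ} (G : SimpleGraph (Fin n)) (root : Fin n) (e : Sym2 (Fin n)) : Prop :=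
  ∃ u v : Fin n, e = s(u, v) ∧ IsChild G root u v ∧ u.val < minLabel (subtreeSet G u v)

/-- The number of twists of `G` (with respect to the given root). -/
noncomputable def numTwists {n : ℕ} (G : SimpleGraph (Fin n)) (root : Fin n) : ℕ :=
  Nat.card {e : Sym2 (Fin n) // e ∈ G.edgeSet ∧ IsTwist G root e}

/-- The number of increasing 1,2-trees on `n` vertices with `m` edges. -/
noncomputable def numInc12Trees (n m : ℕ) : ℕ :=
  Nat.card {G : SimpleGraph (Fin n) // IsIncreasing12Tree G ∧ G.edgeSet.ncard = m}

/-- The number of Cayley trees on `n ≥ 1` vertices (rooted at the vertex with label 1)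
with exactly `j` twists. -/
noncomputable def numCayleyTwist (n j : ℕ) (h : 0 < n) : ℕ :=
  Nat.card {G : SimpleGraph (Fin n) // G.IsTree ∧ numTwists G ⟨0, h⟩ = j}

section Counting

open Polynomial

/-- `growthPoly n a b` enumerates the ways of performing `n` growth steps from a structure with
`a` vertices and `b` edges: a step either selects a vertex and creates one new edge, or selects
an edge, creates two new edges and contributes a factor `X`. -/
noncomputable def growthPoly : ℕ → ℕ → ℕ → ℕ[X]
  | 0, _, _ => 1
  | n + 1, a, b =>
    (a : ℕ[X]) * growthPoly n (a + 1) (b + 1) + (b : ℕ[X]) * X * growthPoly n (a + 1) (b + 2)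

/-- The polynomial enumerating rooted labelled trees on `n` vertices by twists. -/
noncomputable def rootedTreePoly : ℕ → ℕ[X]
  | 0 => 0
  | n + 1 => growthPoly n 1 1

theorem growthPoly_add {α : Type*} [DecidableEq α] (S : Finset α) (a b a' b' : ℕ) :
    growthPoly S.card (a + a') (b + b') =
      ∑ T ∈ S.powerset, growthPoly T.card a b * growthPoly (S \ T).card a' b' := by
  induction S using Finset.induction_on generalizing a b a' b' with
  | empty => simp [growthPoly]
  | insert s S hs ih =>
    have h1 : ∀ T ∈ S.powerset, growthPoly T.card a b *
        growthPoly (insert s S \ T).card a' b' =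
        (a' : ℕ[X]) * (growthPoly T.card a b * growthPoly (S \ T).card (a' + 1) (b' + 1)) +
        (b' : ℕ[X]) * X * (growthPoly T.card a b * growthPoly (S \ T).card (a' + 1) (b' + 2)) := by
      intro T hT
      have hsT : s ∉ T := fun h => hs (Finset.mem_powerset.1 hT h)
      rw [Finset.insert_sdiff_of_notMem _ hsT, Finset.card_insert_of_notMem (by simp [hs]),
        growthPoly]
      ring
    have h2 : ∀ T ∈ S.powerset, growthPoly (insert s T).card a b *
        growthPoly (insert s S \ insert s T).card a' b' =
        (a : ℕ[X]) * (growthPoly T.card (a + 1) (b + 1) * growthPoly (S \ T).card a' b') +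
        (b : ℕ[X]) * X * (growthPoly T.card (a + 1) (b + 2) * growthPoly (S \ T).card a' b') := by
      intro T hT
      have hsT : s ∉ T := fun h => hs (Finset.mem_powerset.1 hT h)
      have hST : insert s S \ insert s T = S \ T := by
        rw [Finset.insert_sdiff_insert, Finset.sdiff_insert_of_notMem hs]
      rw [hST, Finset.card_insert_of_notMem hsT, growthPoly]
      ring
    rw [Finset.sum_powerset_insert hs, Finset.sum_congr rfl h1, Finset.sum_congr rfl h2,
      Finset.sum_add_distrib, Finset.sum_add_distrib, ← Finset.mul_sum, ← Finset.mul_sum,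
      ← Finset.mul_sum, ← Finset.mul_sum, ← ih, ← ih, ← ih, ← ih,
      Finset.card_insert_of_notMem hs, growthPoly, Nat.cast_add, Nat.cast_add]
    ring_nf

theorem growthPoly_succ_right {α : Type*} [DecidableEq α] (S : Finset α) (a b : ℕ) :
    growthPoly S.card a (b + 1) = growthPoly S.card a b +
      X * ∑ T ∈ S.powerset, growthPoly T.card a (b + 1) * rootedTreePoly (S \ T).card := by
  induction S using Finset.induction_on generalizing a b with
  | empty => simp [growthPoly, rootedTreePoly]
  | insert s S hs ih =>
    have h1 : ∀ T ∈ S.powerset, growthPoly T.card a (b + 1) *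
        rootedTreePoly (insert s S \ T).card =
        growthPoly T.card a (b + 1) * growthPoly (S \ T).card 1 1 := by
      intro T hT
      have hsT : s ∉ T := fun h => hs (Finset.mem_powerset.1 hT h)
      rw [Finset.insert_sdiff_of_notMem _ hsT, Finset.card_insert_of_notMem (by simp [hs]),
        rootedTreePoly]
    have h2 : ∀ T ∈ S.powerset, growthPoly (insert s T).card a (b + 1) *
        rootedTreePoly (insert s S \ insert s T).card =
        (a : ℕ[X]) * (growthPoly T.card (a + 1) (b + 2) * rootedTreePoly (S \ T).card) +
        ((b : ℕ[X]) + 1) * X * (growthPoly T.card (a + 1) (b + 3) * rootedTreePoly (S \ T).card) := by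
      intro T hT
      have hsT : s ∉ T := fun h => hs (Finset.mem_powerset.1 hT h)
      have hST : insert s S \ insert s T = S \ T := by
        rw [Finset.insert_sdiff_insert, Finset.sdiff_insert_of_notMem hs]
      rw [hST, Finset.card_insert_of_notMem hsT, growthPoly]
      push_cast
      ring_nf
    rw [Finset.sum_powerset_insert hs, Finset.sum_congr rfl h1, Finset.sum_congr rfl h2,
      Finset.sum_add_distrib, ← Finset.mul_sum, ← Finset.mul_sum, ← growthPoly_add,
      Finset.card_insert_of_notMem hs, growthPoly, growthPoly]
    push_cast
    have e1 := ih (a + 1) (b + 1)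
    have e2 := ih (a + 1) (b + 2)
    simp only [add_assoc, Nat.reduceAdd] at e1 e2 ⊢
    generalize (∑ T ∈ S.powerset, growthPoly T.card (a + 1) (b + 2) *
      rootedTreePoly (S \ T).card) = U at *
    generalize (∑ T ∈ S.powerset, growthPoly T.card (a + 1) (b + 3) *
      rootedTreePoly (S \ T).card) = W at *
    calc _ = (a : ℕ[X]) * growthPoly S.card (a + 1) (b + 2) +
          ((b : ℕ[X]) + 1) * X * growthPoly S.card (a + 1) (b + 3) := by ring
      _ = (a : ℕ[X]) * (growthPoly S.card (a + 1) (b + 1) + X * U) +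
          ((b : ℕ[X]) + 1) * X * (growthPoly S.card (a + 1) (b + 2) + X * W) := by rw [← e1, ← e2]
      _ = _ := by ring

end Counting
section Forests

open Polynomial
open scoped Classical

/-- `v` is obtained from `w` by iterating the parent function `p`. -/
def Reaches {α : Type*} (p : α → α) (w v : α) : Prop := ∃ k, p^[k] w = v

namespace Reaches

variable {α : Type*} {p q : α → α} {u v w : α}

theorem refl (p : α → α) (v : α) : Reaches p v v := ⟨0, rfl⟩

theorem head (h : Reaches p (p w) v) : Reaches p w v := by
  obtain ⟨k, rfl⟩ := h
  exact ⟨k + 1, rfl⟩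

theorem trans (h : Reaches p u v) (h' : Reaches p v w) : Reaches p u w := by
  obtain ⟨k, rfl⟩ := h
  obtain ⟨l, rfl⟩ := h'
  exact ⟨l + k, Function.iterate_add_apply p l k u⟩

theorem eq_or_apply (h : Reaches p w v) : w = v ∨ Reaches p (p w) v := by
  obtain ⟨k, rfl⟩ := h
  cases k with
  | zero => exact Or.inl rfl
  | succ k => exact Or.inr ⟨k, rfl⟩

theorem total (h : Reaches p w u) (h' : Reaches p w v) : Reaches p u v ∨ Reaches p v u := by
  obtain ⟨k, rfl⟩ := h
  obtain ⟨l, rfl⟩ := h'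
  rcases le_total k l with hkl | hkl
  · obtain ⟨m, rfl⟩ := Nat.exists_eq_add_of_le hkl
    exact Or.inl ⟨m, by rw [← Function.iterate_add_apply, add_comm]⟩
  · obtain ⟨m, rfl⟩ := Nat.exists_eq_add_of_le hkl
    exact Or.inr ⟨m, by rw [← Function.iterate_add_apply, add_comm]⟩

/-- Sets whose complement is closed under `p` are closed under taking descendants. -/
theorem mem_of_mem {B : Set α} (hB : ∀ u ∉ B, p u ∉ B) (h : Reaches p w v) (hv : v ∈ B) :
    w ∈ B := by
  obtain ⟨k, rfl⟩ := h
  induction k generalizing w with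
  | zero => exact hv
  | succ k ih =>
    by_contra hw
    exact hB w hw (ih hv)

theorem update [DecidableEq α] (h : Reaches p w v) (x : α) :
    Reaches (Function.update p v x) w v := by
  obtain ⟨k, hk⟩ := h
  induction k generalizing w with
  | zero => exact ⟨0, hk⟩
  | succ k ih =>
    by_cases hw : w = v
    · exact hw ▸ refl _ _
    · have := ih hk
      rw [← Function.update_of_ne hw x p] at this
      exact this.head

theorem congr {B : Set α} (hB : ∀ u ∉ B, p u ∉ B) (hpq : ∀ u ∈ B, p u ∈ B → q u = p u)
    (hv : v ∈ B) (h : Reaches p w v) : Reaches q w v := by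
  obtain ⟨k, hk⟩ := h
  induction k generalizing w with
  | zero => exact ⟨0, hk⟩
  | succ k ih =>
    have hpw : p w ∈ B := mem_of_mem hB ⟨k, hk⟩ hv
    have hw : w ∈ B := by
      by_contra hw
      exact hB w hw hpw
    have := ih hk
    rw [← hpq w hw hpw] at this
    exact this.head

end Reaches

/-- `p` is the parent function of a rooted forest on the vertex set `S`; the roots, and the
elements outside of `S`, are sent to `⊥`. -/
structure IsForest {α : Type*} [LinearOrder α] [OrderBot α] (S : Finset α) (p : α → α) :
    Prop where
  apply_of_notMem : ∀ v ∉ S, p v = ⊥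
  apply_mem : ∀ v ∈ S, p v ≠ ⊥ → p v ∈ S
  exists_rank : ∃ d : α → ℕ, d ⊥ = 0 ∧ ∀ v ∈ S, d (p v) < d v

/-- The vertices of a forest whose parent edge is a twist. -/
noncomputable def twistSet {α : Type*} [LinearOrder α] [Fintype α] (p : α → α) : Finset α :=
  Finset.univ.filter fun v => ∃ w, Reaches p w v ∧ w < p v

theorem mem_twistSet {α : Type*} [LinearOrder α] [Fintype α] {p : α → α} {v : α} :
    v ∈ twistSet p ↔ ∃ w, Reaches p w v ∧ w < p v := by
  simp [twistSet]

theorem mem_twistSet_congr {α : Type*} [LinearOrder α] [Fintype α] {p q : α → α} {B : Set α} {v : α}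
    (hp : ∀ u ∉ B, p u ∉ B) (hq : ∀ u ∉ B, q u ∉ B) (hpq : ∀ u ∈ B, p u ∈ B → q u = p u)
    (hqp : ∀ u ∈ B, q u ∈ B → p u = q u) (hv : v ∈ B) (hpv : p v = q v) :
    v ∈ twistSet p ↔ v ∈ twistSet q := by
  rw [mem_twistSet, mem_twistSet, hpv]
  exact exists_congr fun w => and_congr_left fun _ =>
    ⟨Reaches.congr hp hpq hv, Reaches.congr hq hqp hv⟩

variable {α : Type*} [LinearOrder α] [OrderBot α]

namespace IsForest

variable {S : Finset α} {p : α → α} {u v w : α}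

theorem bot_notMem (hp : IsForest S p) : ⊥ ∉ S := by
  obtain ⟨d, h0, hd⟩ := hp.exists_rank
  intro h
  have := hd _ h
  omega

theorem ne_bot (hp : IsForest S p) (hv : v ∈ S) : v ≠ ⊥ := by
  rintro rfl
  exact hp.bot_notMem hv

theorem apply_bot (hp : IsForest S p) : p ⊥ = ⊥ := hp.apply_of_notMem _ hp.bot_notMem

theorem mem_of_apply_ne_bot (hp : IsForest S p) (h : p v ≠ ⊥) : v ∈ S := by
  by_contra hv
  exact h (hp.apply_of_notMem v hv)

theorem apply_notMem (hp : IsForest S p) : ∀ v ∉ (S : Set α), p v ∉ (S : Set α) := by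
  intro v hv h
  rw [hp.apply_of_notMem v hv] at h
  exact hp.bot_notMem h

theorem mem_of_reaches (hp : IsForest S p) (h : Reaches p w v) (hv : v ∈ S) : w ∈ S :=
  h.mem_of_mem (B := S) hp.apply_notMem hv

theorem eq_bot_of_reaches (hp : IsForest S p) (h : Reaches p ⊥ v) : v = ⊥ := by
  obtain ⟨k, rfl⟩ := h
  exact Function.iterate_fixed hp.apply_bot k

theorem eq_of_reaches_of_root (hp : IsForest S p) (h : Reaches p u v) (hu : p u = ⊥)
    (hv : v ≠ ⊥) : u = v := by
  rcases h.eq_or_apply with h | h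
  · exact h
  · rw [hu] at h
    exact absurd (hp.eq_bot_of_reaches h) hv

theorem root_unique (hp : IsForest S p) (hu : u ≠ ⊥) (hv : v ≠ ⊥) (hpu : p u = ⊥)
    (hpv : p v = ⊥) (hwu : Reaches p w u) (hwv : Reaches p w v) : u = v := by
  rcases hwu.total hwv with h | h
  · exact hp.eq_of_reaches_of_root h hpu hv
  · exact (hp.eq_of_reaches_of_root h hpv hu).symm

theorem exists_root (hp : IsForest S p) (hv : v ∈ S) : ∃ u ∈ S, p u = ⊥ ∧ Reaches p v u := by
  obtain ⟨d, -, hd⟩ := hp.exists_rank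
  induction hn : d v using Nat.strong_induction_on generalizing v with
  | _ n ih =>
    by_cases h0 : p v = ⊥
    · exact ⟨v, hv, h0, Reaches.refl p v⟩
    · obtain ⟨u, hu, hpu, h⟩ := ih _ (hn ▸ hd v hv) (hp.apply_mem v hv h0) rfl
      exact ⟨u, hu, hpu, h.head⟩

theorem not_reaches_apply (hp : IsForest S p) (hv : v ∈ S) : ¬ Reaches p (p v) v := by
  obtain ⟨d, h0, hd⟩ := hp.exists_rank
  rintro ⟨k, hk⟩
  have hle : ∀ k w, d (p^[k] w) ≤ d w := by
    intro k
    induction k with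
    | zero => intro w; exact le_rfl
    | succ k ih =>
      intro w
      refine (ih (p w)).trans ?_
      by_cases hw : w ∈ S
      · exact (hd w hw).le
      · rw [hp.apply_of_notMem w hw, h0]
        exact Nat.zero_le _
  have h1 := hle k (p v)
  have h2 := hd v hv
  rw [hk] at h1
  omega

theorem exists_child_of_root (hp : IsForest S p) (h : p v ≠ ⊥) :
    ∃ c ∈ S, Reaches p v c ∧ p c ≠ ⊥ ∧ p (p c) = ⊥ := by
  obtain ⟨d, -, hd⟩ := hp.exists_rank
  induction hn : d v using Nat.strong_induction_on generalizing v with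
  | _ n ih =>
    have hv := hp.mem_of_apply_ne_bot h
    by_cases h0 : p (p v) = ⊥
    · exact ⟨v, hv, Reaches.refl p v, h, h0⟩
    · obtain ⟨c, hc, hvc, h'⟩ := ih _ (hn ▸ hd v hv) h0 rfl
      exact ⟨c, hc, hvc.head, h'⟩

theorem child_of_root_unique (hp : IsForest S p) (hwu : Reaches p w u) (hwv : Reaches p w v)
    (hu : p u ≠ ⊥) (hu' : p (p u) = ⊥) (hv : p v ≠ ⊥) (hv' : p (p v) = ⊥) : u = v := by
  have key : ∀ {a b}, Reaches p a b → p (p a) = ⊥ → p b ≠ ⊥ → a = b := by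
    intro a b h ha hb
    rcases h.eq_or_apply with h | h
    · exact h
    · rcases h.eq_or_apply with h | h
      · exact absurd (h ▸ ha) hb
      · rw [ha] at h
        rw [hp.eq_bot_of_reaches h] at hb
        exact absurd hp.apply_bot hb
  rcases hwu.total hwv with h | h
  · exact key h hu' hv
  · exact (key h hv' hu).symm

theorem cut (hp : IsForest S p) (c : α) : IsForest S (Function.update p c ⊥) := by
  obtain ⟨d, h0, hd⟩ := hp.exists_rank
  refine ⟨?_, ?_, d, h0, ?_⟩
  · intro v hv
    by_cases h : v = c
    · rw [h, Function.update_self]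
    · rw [Function.update_of_ne h, hp.apply_of_notMem v hv]
  · intro v hv
    by_cases h : v = c
    · rw [h, Function.update_self]
      exact absurd rfl
    · rw [Function.update_of_ne h]
      exact hp.apply_mem v hv
  · intro v hv
    by_cases h : v = c
    · subst h
      rw [Function.update_self, h0]
      exact (Nat.zero_le _).trans_lt (hd v hv)
    · rw [Function.update_of_ne h]
      exact hd v hv

theorem link (hp : IsForest S p) (hu : u ∈ S) (hv : v ∈ S) (huv : u ≠ v) (hpv : p v = ⊥) :
    IsForest S (Function.update p u v) := by
  obtain ⟨d, h0, hd⟩ := hp.exists_rank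
  have hvu : ¬ Reaches p v u := fun h =>
    huv (hp.eq_of_reaches_of_root h hpv (hp.ne_bot hu)).symm
  refine ⟨?_, ?_, fun w => if w ∈ S ∧ Reaches p w u then d w + d v + 1 else d w, ?_, ?_⟩
  · intro w hw
    have hwu : w ≠ u := fun h => hw (h ▸ hu)
    rw [Function.update_of_ne hwu, hp.apply_of_notMem w hw]
  · intro w hw
    by_cases h : w = u
    · rw [h, Function.update_self]
      exact fun _ => hv
    · rw [Function.update_of_ne h]
      exact hp.apply_mem w hw
  · simp [hp.bot_notMem, h0]
  · intro w hw
    by_cases h : w = u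
    · subst h
      simp only [Function.update_self, hvu, and_false, if_false, hw, Reaches.refl, and_self,
        if_true]
      omega
    · have hdw := hd w hw
      simp only [Function.update_of_ne h, hw, true_and]
      by_cases hwu : Reaches p w u
      · rw [if_pos hwu]
        split_ifs <;> omega
      · rw [if_neg hwu, if_neg fun h' => hwu h'.2.head]
        exact hdw

theorem reaches_bot (hp : IsForest S p) (v : α) : Reaches p v ⊥ := by
  by_cases hv : v ∈ S
  · obtain ⟨u, -, hu, h⟩ := hp.exists_root hv
    exact h.trans ⟨1, hu⟩
  · exact ⟨1, hp.apply_of_notMem v hv⟩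

end IsForest

/-- The roots of a forest on `S`. -/
noncomputable def forestRoots (S : Finset α) (p : α → α) : Finset α := S.filter fun v => p v = ⊥

theorem mem_forestRoots {S : Finset α} {p : α → α} {v : α} :
    v ∈ forestRoots S p ↔ v ∈ S ∧ p v = ⊥ := Finset.mem_filter

/-- The vertices of the tree of the forest `p` containing `s`. -/
noncomputable def treeOf (S : Finset α) (p : α → α) (s : α) : Finset α :=
  S.filter fun v => ∃ u, u ≠ ⊥ ∧ p u = ⊥ ∧ Reaches p s u ∧ Reaches p v u

/-- `B` is the vertex set of a tree of the forest with parent function `p`. -/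
structure IsTreeOf (p : α → α) (B : Finset α) : Prop where
  apply_mem : ∀ v ∈ B, p v ≠ ⊥ → p v ∈ B
  apply_notMem : ∀ v ∉ B, p v ∉ B
  card_roots : (forestRoots B p).card = 1

theorem treeOf_eq_iff {S B : Finset α} {p : α → α} {s : α} (hp : IsForest S p) (hs : s ∈ B)
    (hB : B ⊆ S) : treeOf S p s = B ↔ IsTreeOf p B := by
  constructor
  · rintro rfl
    simp only [treeOf, Finset.mem_filter] at hs
    obtain ⟨hsS, -⟩ := hs
    refine ⟨?_, ?_, ?_⟩
    · intro v hv h0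
      simp only [treeOf, Finset.mem_filter] at hv ⊢
      obtain ⟨hvS, u, hu, hpu, hsu, hvu⟩ := hv
      refine ⟨hp.apply_mem v hvS h0, u, hu, hpu, hsu, ?_⟩
      rcases hvu.eq_or_apply with rfl | h
      · exact absurd hpu h0
      · exact h
    · intro v hv hpv
      simp only [treeOf, Finset.mem_filter] at hv hpv
      obtain ⟨hvS, u, hu, hpu, hsu, hvu⟩ := hpv
      exact hv ⟨hp.mem_of_apply_ne_bot (hp.ne_bot hvS), u, hu, hpu, hsu, hvu.head⟩
    · obtain ⟨u, huS, hpu, hsu⟩ := hp.exists_root hsS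
      refine Finset.card_eq_one.2 ⟨u, ?_⟩
      ext v
      simp only [forestRoots, treeOf, Finset.mem_filter, Finset.mem_singleton]
      constructor
      · rintro ⟨⟨hvS, u', hu', hpu', hsu', hvu'⟩, hv⟩
        rw [hp.root_unique (hp.ne_bot huS) hu' hpu hpu' hsu hsu']
        exact hp.eq_of_reaches_of_root hvu' hv hu'
      · rintro rfl
        exact ⟨⟨huS, v, hp.ne_bot huS, hpu, hsu, Reaches.refl p v⟩, hpu⟩
  · intro h
    have key : ∀ v ∈ B, ∀ u, u ≠ ⊥ → Reaches p v u → u ∈ B := by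
      rintro v hv u hu ⟨k, rfl⟩
      induction k generalizing v with
      | zero => exact hv
      | succ k ih =>
        refine ih (p v) (h.apply_mem v hv ?_) hu
        intro h0
        exact hu (hp.eq_bot_of_reaches ⟨k, by rw [Function.iterate_succ_apply, h0]⟩)
    obtain ⟨r, hr⟩ := Finset.card_eq_one.1 h.card_roots
    have hr' : ∀ v ∈ B, p v = ⊥ → v = r := by
      intro v hv h0
      rw [← Finset.mem_singleton, ← hr]
      exact Finset.mem_filter.2 ⟨hv, h0⟩
    ext v
    simp only [treeOf, Finset.mem_filter]
    constructor
    · rintro ⟨hvS, u, hu, hpu, hsu, hvu⟩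
      exact hvu.mem_of_mem (B := B) h.apply_notMem (key s hs u hu hsu)
    · intro hv
      obtain ⟨u, huS, hpu, hvu⟩ := hp.exists_root (hB hv)
      obtain ⟨u', huS', hpu', hsu'⟩ := hp.exists_root (hB hs)
      have e : u = u' := by
        rw [hr' u (key v hv u (hp.ne_bot huS) hvu) hpu,
          hr' u' (key s hs u' (hp.ne_bot huS') hsu') hpu']
      exact ⟨hB hv, u, hp.ne_bot huS, hpu, e ▸ hsu', hvu⟩

theorem treeOf_subset (S : Finset α) (p : α → α) (s : α) : treeOf S p s ⊆ S :=
  Finset.filter_subset _ _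

theorem IsForest.self_mem_treeOf {S : Finset α} {p : α → α} {s : α} (hp : IsForest S p)
    (hs : s ∈ S) : s ∈ treeOf S p s := by
  obtain ⟨u, hu, hpu, h⟩ := hp.exists_root hs
  exact Finset.mem_filter.2 ⟨hs, u, hp.ne_bot hu, hpu, h, h⟩

theorem IsForest.piecewise {B C : Finset α} {q q' : α → α} (hBC : Disjoint B C)
    (hq : IsForest B q) (hq' : IsForest C q') : IsForest (B ∪ C) (B.piecewise q q') := by
  obtain ⟨d, h0, hd⟩ := hq.exists_rank
  obtain ⟨d', h0', hd'⟩ := hq'.exists_rank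
  have hC : ∀ v ∈ C, v ∉ B := fun v hv hv' => Finset.disjoint_left.1 hBC hv' hv
  have hbot : B.piecewise d d' ⊥ = 0 := by
    rw [Finset.piecewise_eq_of_notMem _ _ _ hq.bot_notMem, h0']
  refine ⟨?_, ?_, B.piecewise d d', hbot, ?_⟩
  · intro v hv
    rw [Finset.mem_union, not_or] at hv
    rw [Finset.piecewise_eq_of_notMem _ _ _ hv.1, hq'.apply_of_notMem v hv.2]
  · intro v hv
    by_cases hvB : v ∈ B
    · rw [Finset.piecewise_eq_of_mem _ _ _ hvB]
      exact fun h => Finset.mem_union_left _ (hq.apply_mem v hvB h)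
    · rw [Finset.piecewise_eq_of_notMem _ _ _ hvB]
      exact fun h => Finset.mem_union_right _
        (hq'.apply_mem v ((Finset.mem_union.1 hv).resolve_left hvB) h)
  · intro v hv
    by_cases hvB : v ∈ B
    · rw [Finset.piecewise_eq_of_mem _ q _ hvB, Finset.piecewise_eq_of_mem _ d _ hvB]
      by_cases h : q v = ⊥
      · rw [h, hbot]
        exact (Nat.zero_le _).trans_lt (hd v hvB)
      · rw [Finset.piecewise_eq_of_mem _ d _ (hq.apply_mem v hvB h)]
        exact hd v hvB
    · have hvC := (Finset.mem_union.1 hv).resolve_left hvB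
      rw [Finset.piecewise_eq_of_notMem _ q _ hvB, Finset.piecewise_eq_of_notMem _ d _ hvB]
      by_cases h : q' v = ⊥
      · rw [h, hbot]
        exact (Nat.zero_le _).trans_lt (hd' v hvC)
      · rw [Finset.piecewise_eq_of_notMem _ d _ (hC _ (hq'.apply_mem v hvC h))]
        exact hd' v hvC

theorem IsForest.restrict {S B : Finset α} {p : α → α} (hp : IsForest S p) (hB : B ⊆ S)
    (hpB : ∀ v ∈ B, p v ≠ ⊥ → p v ∈ B) : IsForest B (B.piecewise p fun _ => ⊥) := by
  obtain ⟨d, h0, hd⟩ := hp.exists_rank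
  refine ⟨?_, ?_, d, h0, ?_⟩
  · intro v hv
    rw [Finset.piecewise_eq_of_notMem _ _ _ hv]
  · intro v hv
    rw [Finset.piecewise_eq_of_mem _ _ _ hv]
    exact hpB v hv
  · intro v hv
    rw [Finset.piecewise_eq_of_mem _ _ _ hv]
    exact hd v (hB hv)

theorem forestRoots_congr {S : Finset α} {p q : α → α} (h : ∀ v ∈ S, p v = q v) :
    forestRoots S p = forestRoots S q :=
  Finset.filter_congr fun v hv => by rw [h v hv]

theorem card_forestRoots_union {B C : Finset α} {p : α → α} (hBC : Disjoint B C) :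
    (forestRoots (B ∪ C) p).card = (forestRoots B p).card + (forestRoots C p).card := by
  rw [forestRoots, Finset.filter_union]
  exact Finset.card_union_of_disjoint (Finset.disjoint_filter_filter hBC)

theorem eq_of_card_forestRoots_eq_one {S : Finset α} {p : α → α} {u v : α}
    (h : (forestRoots S p).card = 1) (hu : u ∈ S) (hv : v ∈ S) (hpu : p u = ⊥)
    (hpv : p v = ⊥) : u = v :=
  Finset.card_le_one.1 h.le u (mem_forestRoots.2 ⟨hu, hpu⟩) v (mem_forestRoots.2 ⟨hv, hpv⟩)

variable [Fintype α]

/-- The parent functions of the rooted forests on `S`. -/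
noncomputable def forests (S : Finset α) : Finset (α → α) :=
  Finset.univ.filter fun p => IsForest S p

theorem mem_forests {S : Finset α} {p : α → α} : p ∈ forests S ↔ IsForest S p := by
  simp [forests]

theorem apply_ne_bot_of_mem_twistSet {p : α → α} {v : α} (h : v ∈ twistSet p) : p v ≠ ⊥ := by
  obtain ⟨w, -, hw⟩ := mem_twistSet.1 h
  exact (bot_le.trans_lt hw).ne'

theorem twistSet_piecewise {B C : Finset α} {q q' : α → α} (hBC : Disjoint B C)
    (hq : IsForest B q) (hq' : IsForest C q') :
    (twistSet (B.piecewise q q')).card = (twistSet q).card + (twistSet q').card := by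
  have hdisj : Disjoint (twistSet q) (twistSet q') := by
    rw [Finset.disjoint_left]
    intro v hv hv'
    exact Finset.disjoint_left.1 hBC
      (hq.mem_of_apply_ne_bot (apply_ne_bot_of_mem_twistSet hv))
      (hq'.mem_of_apply_ne_bot (apply_ne_bot_of_mem_twistSet hv'))
  rw [← Finset.card_union_of_disjoint hdisj]
  congr 1
  have hC : ∀ v ∈ C, v ∉ B := fun v hv hv' => Finset.disjoint_left.1 hBC hv' hv
  have outB : ∀ u ∉ (B : Set α), B.piecewise q q' u ∉ (B : Set α) := by
    intro u hu h
    rw [Finset.piecewise_eq_of_notMem _ _ _ hu] at h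
    by_cases huC : u ∈ C
    · exact hC _ (hq'.apply_mem u huC (hq.ne_bot h)) h
    · rw [hq'.apply_of_notMem u huC] at h
      exact hq.bot_notMem h
  have outC : ∀ u ∉ (C : Set α), B.piecewise q q' u ∉ (C : Set α) := by
    intro u hu h
    by_cases huB : u ∈ B
    · rw [Finset.piecewise_eq_of_mem _ _ _ huB] at h
      exact hC _ h (hq.apply_mem u huB (hq'.ne_bot h))
    · rw [Finset.piecewise_eq_of_notMem _ _ _ huB, hq'.apply_of_notMem u hu] at h
      exact hq'.bot_notMem h
  ext v
  rw [Finset.mem_union]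
  by_cases hvB : v ∈ B
  · have hvC : v ∉ C := fun h => hC v h hvB
    have h1 : v ∉ twistSet q' := fun h =>
      apply_ne_bot_of_mem_twistSet h (hq'.apply_of_notMem v hvC)
    rw [or_iff_left h1]
    refine mem_twistSet_congr (B := B) outB hq.apply_notMem ?_ ?_ hvB
      (Finset.piecewise_eq_of_mem _ _ _ hvB)
    · intro u hu _
      exact (Finset.piecewise_eq_of_mem _ _ _ hu).symm
    · intro u hu _
      exact Finset.piecewise_eq_of_mem _ _ _ hu
  · have h1 : v ∉ twistSet q := fun h =>
      apply_ne_bot_of_mem_twistSet h (hq.apply_of_notMem v hvB)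
    rw [or_iff_right h1]
    by_cases hvC : v ∈ C
    · refine mem_twistSet_congr (B := C) outC hq'.apply_notMem ?_ ?_ hvC
        (Finset.piecewise_eq_of_notMem _ _ _ hvB)
      · intro u hu _
        exact (Finset.piecewise_eq_of_notMem _ _ _ (hC u hu)).symm
      · intro u hu _
        exact Finset.piecewise_eq_of_notMem _ _ _ (hC u hu)
    · have h2 := hq'.apply_of_notMem v hvC
      exact iff_of_false
        (fun h => apply_ne_bot_of_mem_twistSet h
          (by rw [Finset.piecewise_eq_of_notMem _ _ _ hvB, h2]))
        (fun h => apply_ne_bot_of_mem_twistSet h h2)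

/-- The parent functions of the rooted trees on `S`. -/
noncomputable def rootedTrees (S : Finset α) : Finset (α → α) :=
  (forests S).filter fun p => (forestRoots S p).card = 1

theorem mem_rootedTrees {S : Finset α} {p : α → α} :
    p ∈ rootedTrees S ↔ IsForest S p ∧ (forestRoots S p).card = 1 := by
  simp [rootedTrees, mem_forests]

theorem sum_forests_eq_sum_powerset {S : Finset α} {s : α} (hs : s ∈ S) (g : ℕ → ℕ[X]) :
    ∑ p ∈ forests S, X ^ (twistSet p).card * g (forestRoots S p).card =
      ∑ A ∈ (S.erase s).powerset, (∑ q ∈ rootedTrees (insert s A), X ^ (twistSet q).card) *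
        ∑ q ∈ forests (S.erase s \ A),
          X ^ (twistSet q).card * g (1 + (forestRoots (S.erase s \ A) q).card) := by
  have hmaps : ∀ p ∈ forests S, (treeOf S p s).erase s ∈ (S.erase s).powerset := fun p _ =>
    Finset.mem_powerset.2 (Finset.erase_subset_erase _ (treeOf_subset S p s))
  rw [← Finset.sum_fiberwise_of_maps_to hmaps]
  refine Finset.sum_congr rfl fun A hA => ?_
  rw [Finset.mem_powerset] at hA
  have hsA : s ∉ A := fun h => Finset.notMem_erase s S (hA h)
  generalize hB : insert s A = B
  generalize hC : S.erase s \ A = C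
  have hsB : s ∈ B := hB ▸ Finset.mem_insert_self s A
  have hBC : Disjoint B C := by
    rw [← hB, ← hC, Finset.disjoint_left]
    intro v
    simp only [Finset.mem_insert, Finset.mem_sdiff, Finset.mem_erase]
    tauto
  have hS : S = B ∪ C := by
    rw [← hB, ← hC]
    ext v
    have := @hA v
    by_cases hv : v = s
    · simp [hv, hs]
    · simp only [Finset.mem_erase, Finset.mem_union, Finset.mem_insert, Finset.mem_sdiff] at *
      tauto
  have hBS : B ⊆ S := hS ▸ Finset.subset_union_left
  have hCS : C ⊆ S := hS ▸ Finset.subset_union_right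
  have htree : ∀ p, p ∈ (forests S).filter (fun p => (treeOf S p s).erase s = A) ↔
      IsForest S p ∧ IsTreeOf p B := by
    intro p
    rw [Finset.mem_filter, mem_forests]
    refine and_congr_right fun hp => ?_
    rw [← treeOf_eq_iff hp hsB hBS, ← hB]
    constructor
    · intro h
      rw [← h, Finset.insert_erase (hp.self_mem_treeOf hs)]
    · intro h
      rw [h, Finset.erase_insert hsA]
  rw [Finset.sum_mul_sum, ← Finset.sum_product']
  have hglue : ∀ p, IsForest S p →
      B.piecewise (B.piecewise p fun _ => ⊥) (C.piecewise p fun _ => ⊥) = p := by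
    intro p hp
    ext v
    by_cases hvB : v ∈ B
    · simp [hvB]
    · by_cases hvC : v ∈ C
      · simp [hvB, hvC]
      · have hvS : v ∉ S := by
          rw [hS, Finset.mem_union]
          tauto
        simp [hvB, hvC, hp.apply_of_notMem v hvS]
  have hrest : ∀ p, IsForest S p → IsTreeOf p B → IsForest B (B.piecewise p fun _ => ⊥) ∧
      IsForest C (C.piecewise p fun _ => ⊥) := by
    intro p hp ht
    refine ⟨hp.restrict hBS ht.apply_mem, hp.restrict hCS fun v hv h0 => ?_⟩
    have h1 := hp.apply_mem v (hCS hv) h0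
    rw [hS, Finset.mem_union] at h1
    exact h1.resolve_left (ht.apply_notMem v fun h => Finset.disjoint_left.1 hBC h hv)
  refine Finset.sum_nbij' (fun p => (B.piecewise p fun _ => ⊥, C.piecewise p fun _ => ⊥))
    (fun x => B.piecewise x.1 x.2) ?_ ?_ ?_ ?_ ?_
  · intro p hp
    obtain ⟨hp, ht⟩ := (htree p).1 hp
    rw [Finset.mem_product, mem_rootedTrees, mem_forests]
    refine ⟨⟨(hrest p hp ht).1, ?_⟩, (hrest p hp ht).2⟩
    dsimp only
    rw [← ht.card_roots]
    exact congrArg Finset.card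
      (forestRoots_congr fun v hv => Finset.piecewise_eq_of_mem _ p _ hv)
  · rintro ⟨q, q'⟩ hx
    rw [Finset.mem_product, mem_rootedTrees, mem_forests] at hx
    obtain ⟨⟨hq, hq1⟩, hq'⟩ := hx
    refine (htree _).2 ⟨hS ▸ hq.piecewise hBC hq', ?_, ?_, ?_⟩
    · intro v hv
      rw [Finset.piecewise_eq_of_mem _ _ _ hv]
      exact hq.apply_mem v hv
    · intro v hv
      rw [Finset.piecewise_eq_of_notMem _ _ _ hv]
      intro h
      by_cases hvC : v ∈ C
      · exact Finset.disjoint_left.1 hBC h (hq'.apply_mem v hvC (hq.ne_bot h))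
      · exact hq.ne_bot h (hq'.apply_of_notMem v hvC)
    · rw [← hq1]
      exact congrArg Finset.card
        (forestRoots_congr fun v hv => Finset.piecewise_eq_of_mem _ _ _ hv)
  · intro p hp
    exact hglue p ((htree p).1 hp).1
  · rintro ⟨q, q'⟩ hx
    rw [Finset.mem_product, mem_rootedTrees, mem_forests] at hx
    obtain ⟨⟨hq, -⟩, hq'⟩ := hx
    dsimp only at hq hq'
    refine Prod.ext ?_ ?_ <;> funext v
    · by_cases hvB : v ∈ B
      · simp [hvB]
      · simp [hvB, (hq.apply_of_notMem v hvB).symm]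
    · by_cases hvC : v ∈ C
      · have hvB : v ∉ B := fun h => Finset.disjoint_left.1 hBC h hvC
        simp [hvB, hvC]
      · simp [hvC, (hq'.apply_of_notMem v hvC).symm]
  · intro p hp
    obtain ⟨hp, ht⟩ := (htree p).1 hp
    have h1 : (twistSet p).card = (twistSet (B.piecewise p fun _ => ⊥)).card +
        (twistSet (C.piecewise p fun _ => ⊥)).card := by
      rw [← twistSet_piecewise hBC (hrest p hp ht).1 (hrest p hp ht).2, hglue p hp]
    have h2 : (forestRoots S p).card =
        1 + (forestRoots C (C.piecewise p fun _ => ⊥)).card := by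
      have h3 : forestRoots C (C.piecewise p fun _ => ⊥) = forestRoots C p :=
        forestRoots_congr fun v hv => Finset.piecewise_eq_of_mem _ _ _ hv
      rw [hS, card_forestRoots_union hBC, ht.card_roots, h3]
    rw [h1, h2, pow_add, mul_assoc]

theorem Finset.sum_eq_sum_of_rel {ι κ M : Type*} [AddCommMonoid M] {s : Finset ι}
    {t : Finset κ} {f : ι → M} {g : κ → M} (R : ι → κ → Prop) (hst : ∀ x ∈ s, ∃ y ∈ t, R x y)
    (hts : ∀ y ∈ t, ∃ x ∈ s, R x y) (hl : ∀ x ∈ s, ∀ y y', R x y → R x y' → y = y')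
    (hr : ∀ y ∈ t, ∀ x x', R x y → R x' y → x = x')
    (hfg : ∀ x ∈ s, ∀ y ∈ t, R x y → f x = g y) : ∑ x ∈ s, f x = ∑ y ∈ t, g y := by
  choose i hi hR using hst
  refine Finset.sum_bij i hi ?_ ?_ fun x hx => hfg x hx _ (hi x hx) (hR x hx)
  · intro x hx x' hx' h
    exact hr _ (hi x hx) x x' (hR x hx) (h ▸ hR x' hx')
  · intro y hy
    obtain ⟨x, hx, h⟩ := hts y hy
    exact ⟨x, hx, hl x hx _ _ (hR x hx) h⟩

/-- Deleting a root that is the minimum. -/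
theorem sum_rootedTrees_root_min {S : Finset α} {s : α} (hS : ⊥ ∉ S) (hs : s ∈ S)
    (hmin : ∀ v ∈ S, s ≤ v) :
    ∑ p ∈ (rootedTrees S).filter (fun p => p s = ⊥), X ^ (twistSet p).card =
      ∑ q ∈ forests (S.erase s), (X : ℕ[X]) ^ (twistSet q).card := by
  have hsbot : s ≠ ⊥ := fun h => hS (h ▸ hs)
  refine Finset.sum_nbij' (fun p v => if p v = s then ⊥ else p v)
    (fun q v => if v ∈ S.erase s ∧ q v = ⊥ then s else q v) ?_ ?_ ?_ ?_ ?_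
  · intro p hp
    rw [Finset.mem_filter, mem_rootedTrees] at hp
    obtain ⟨⟨hp, h1⟩, hps⟩ := hp
    rw [mem_forests]
    obtain ⟨d, h0, hd⟩ := hp.exists_rank
    refine ⟨?_, ?_, d, h0, ?_⟩
    · intro v hv
      by_cases hvs : v = s
      · simp [hvs, hps]
      · simp [hp.apply_of_notMem v fun h => hv (Finset.mem_erase.2 ⟨hvs, h⟩)]
    · intro v hv h
      split_ifs at h ⊢ with h2
      · exact absurd rfl h
      · exact Finset.mem_erase.2 ⟨h2, hp.apply_mem v (Finset.mem_of_mem_erase hv) h⟩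
    · intro v hv
      have := hd v (Finset.mem_of_mem_erase hv)
      split_ifs <;> omega
  · intro q hq
    rw [mem_forests] at hq
    obtain ⟨d, h0, hd⟩ := hq.exists_rank
    have hqs : q s = ⊥ := hq.apply_of_notMem s (Finset.notMem_erase s S)
    have hps : (if s ∈ S.erase s ∧ q s = ⊥ then s else q s) = ⊥ := by simp [hqs]
    rw [Finset.mem_filter, mem_rootedTrees]
    refine ⟨⟨⟨?_, ?_, fun v => if v = s then 1 else if v ∈ S then d v + 1 else 0, ?_, ?_⟩, ?_⟩,
      hps⟩
    · intro v hv
      have hv' : v ∉ S.erase s := fun h => hv (Finset.mem_of_mem_erase h)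
      simp only [hv', false_and, if_false]
      exact hq.apply_of_notMem v hv'
    · intro v hv h
      by_cases hvs : v = s
      · subst hvs
        exact absurd hps h
      · have hv' : v ∈ S.erase s := Finset.mem_erase.2 ⟨hvs, hv⟩
        by_cases hqv : q v = ⊥
        · simpa [hv', hqv] using hs
        · simpa [hv', hqv] using Finset.mem_of_mem_erase (hq.apply_mem v hv' hqv)
    · simp [hsbot.symm, hS]
    · intro v hv
      by_cases hvs : v = s
      · subst hvs
        simp [hqs, hsbot.symm, hS]
      · have hv' : v ∈ S.erase s := Finset.mem_erase.2 ⟨hvs, hv⟩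
        have hdv := hd v hv'
        by_cases hqv : q v = ⊥
        · rw [hqv, h0] at hdv
          simp only [hv', hqv, and_self, if_true, hvs, if_false, hv]
          omega
        · have h' := Finset.mem_erase.1 (hq.apply_mem v hv' hqv)
          simp only [hqv, and_false, hvs, if_false, hv, h'.1, h'.2, if_true]
          omega
    · rw [Finset.card_eq_one]
      refine ⟨s, ?_⟩
      ext v
      simp only [forestRoots, Finset.mem_filter, Finset.mem_singleton]
      constructor
      · rintro ⟨hv, h⟩
        by_contra hvs
        have hv' : v ∈ S.erase s := Finset.mem_erase.2 ⟨hvs, hv⟩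
        split_ifs at h with h2
        · exact hsbot h
        · exact h2 ⟨hv', h⟩
      · rintro rfl
        exact ⟨hs, hps⟩
  · intro p hp
    rw [Finset.mem_filter, mem_rootedTrees] at hp
    obtain ⟨⟨hp, h1⟩, hps⟩ := hp
    funext v
    dsimp only
    by_cases hv : v ∈ S.erase s
    · have hv0 : p v ≠ ⊥ := fun h => (Finset.mem_erase.1 hv).1
        (eq_of_card_forestRoots_eq_one h1 (Finset.mem_of_mem_erase hv) hs h hps)
      by_cases h : p v = s
      · simp [hv, h]
      · simp [h, hv0]
    · by_cases h : v = s
      · simp [h, hps, hsbot.symm]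
      · have := hp.apply_of_notMem v fun hv' => hv (Finset.mem_erase.2 ⟨h, hv'⟩)
        simp [hv, this, hsbot.symm]
  · intro q hq
    rw [mem_forests] at hq
    funext v
    by_cases hv : v ∈ S.erase s ∧ q v = ⊥
    · simp [hv]
    · have hqs : q v ≠ s := by
        intro h
        have hq0 : q v ≠ ⊥ := h ▸ hsbot
        exact Finset.notMem_erase s S (h ▸ hq.apply_mem v (hq.mem_of_apply_ne_bot hq0) hq0)
      simp only [hv, if_false, hqs]
  · intro p hp
    rw [Finset.mem_filter, mem_rootedTrees] at hp
    obtain ⟨⟨hp, h1⟩, hps⟩ := hp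
    congr 2
    ext v
    by_cases hv : v ∈ S.erase s
    · by_cases hpv : p v = s
      · refine iff_of_false ?_ fun h => apply_ne_bot_of_mem_twistSet h (if_pos hpv)
        intro h
        obtain ⟨w, hwv, hw⟩ := mem_twistSet.1 h
        rw [hpv] at hw
        exact hw.not_ge (hmin w (hp.mem_of_reaches hwv (Finset.mem_of_mem_erase hv)))
      · have hout : ∀ u ∉ (S.erase s : Set α), p u ∉ (S.erase s : Set α) := by
          intro u hu h
          have hpu : p u ≠ ⊥ := fun h' => hS (h' ▸ Finset.mem_of_mem_erase h)
          refine hu (Finset.mem_erase.2 ⟨?_, hp.mem_of_apply_ne_bot hpu⟩)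
          rintro rfl
          exact hpu hps
        refine mem_twistSet_congr (B := (S.erase s : Set α)) hout ?_ ?_ ?_ hv (if_neg hpv).symm
        · intro u hu h
          split_ifs at h with h2
          · exact hS (Finset.mem_of_mem_erase h)
          · exact hout u hu h
        · intro u _ h
          exact if_neg (Finset.mem_erase.1 h).1
        · intro u _ h
          split_ifs at h ⊢ with h2
          · exact absurd (Finset.mem_of_mem_erase h) hS
          · rfl
    · have hpv : p v = ⊥ := by
        by_cases h : v = s
        · rw [h, hps]
        · exact hp.apply_of_notMem v fun hv' => hv (Finset.mem_erase.2 ⟨h, hv'⟩)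
      refine iff_of_false (fun h => apply_ne_bot_of_mem_twistSet h hpv)
        fun h => apply_ne_bot_of_mem_twistSet h ?_
      simp [hpv]

theorem twistSet_link {S : Finset α} {q : α → α} {s c ρ : α} (hq : IsForest S q)
    (hmin : ∀ v ∈ S, s ≤ v) (hc : c ∈ S) (hρ : ρ ∈ S) (hcρ : c ≠ ρ)
    (hqc : q c = ⊥) (hqρ : q ρ = ⊥) (hsc : Reaches q s c) :
    (twistSet (Function.update q c ρ)).card = (twistSet q).card + 1 := by
  have hcq : c ∉ twistSet q := fun h => apply_ne_bot_of_mem_twistSet h hqc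
  rw [← Finset.card_insert_of_notMem hcq]
  congr 1
  ext v
  rw [Finset.mem_insert]
  by_cases hvc : v = c
  · subst hvc
    refine iff_of_true (mem_twistSet.2 ⟨s, hsc.update ρ, ?_⟩) (Or.inl rfl)
    rw [Function.update_self]
    refine lt_of_le_of_ne (hmin ρ hρ) ?_
    rintro rfl
    exact hcρ (hq.eq_of_reaches_of_root hsc hqρ (hq.ne_bot hc)).symm
  · rw [or_iff_right hvc]
    by_cases hv : v ∈ S ∧ v ≠ ρ
    · have hbot : ⊥ ∉ {u | u ∈ S ∧ u ≠ ρ} := fun h => hq.bot_notMem h.1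
      have hout : ∀ u ∉ {u | u ∈ S ∧ u ≠ ρ}, q u ∉ {u | u ∈ S ∧ u ≠ ρ} := by
        intro u hu h
        have hqu : q u ≠ ⊥ := hq.ne_bot h.1
        refine hu ⟨hq.mem_of_apply_ne_bot hqu, ?_⟩
        rintro rfl
        exact hqu hqρ
      refine mem_twistSet_congr (B := {u | u ∈ S ∧ u ≠ ρ}) ?_ hout ?_ ?_ hv
        (Function.update_of_ne hvc _ _)
      · intro u hu
        rw [Function.update_of_ne]
        · exact hout u hu
        · rintro rfl
          exact hu ⟨hc, hcρ⟩
      · intro u _ h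
        rw [Function.update_of_ne]
        rintro rfl
        rw [Function.update_self] at h
        exact h.2 rfl
      · intro u _ h
        rw [Function.update_of_ne]
        rintro rfl
        exact hbot (hqc ▸ h)
    · have hqv : q v = ⊥ := by
        by_cases hvS : v ∈ S
        · rw [not_and_not_right.1 hv hvS, hqρ]
        · exact hq.apply_of_notMem v hvS
      exact iff_of_false
        (fun h => apply_ne_bot_of_mem_twistSet h (by rw [Function.update_of_ne hvc, hqv]))
        (fun h => apply_ne_bot_of_mem_twistSet h hqv)

/-- Cutting the edge at the root above the minimum. -/
theorem sum_rootedTrees_root_ne_min {S : Finset α} {s : α} (hs : s ∈ S)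
    (hmin : ∀ v ∈ S, s ≤ v) :
    ∑ p ∈ (rootedTrees S).filter (fun p => p s ≠ ⊥), X ^ (twistSet p).card =
      ∑ q ∈ (forests S).filter (fun q => (forestRoots S q).card = 2),
        (X : ℕ[X]) ^ ((twistSet q).card + 1) := by
  symm
  refine Finset.sum_eq_sum_of_rel (fun q p => ∃ c ρ, c ∈ S ∧ ρ ∈ S ∧ c ≠ ρ ∧ q c = ⊥ ∧
    q ρ = ⊥ ∧ Reaches q s c ∧ p = Function.update q c ρ) ?_ ?_ ?_ ?_ ?_
  · intro q hq
    rw [Finset.mem_filter, mem_forests] at hq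
    obtain ⟨hq, h2⟩ := hq
    obtain ⟨c, hc, hqc, hsc⟩ := hq.exists_root hs
    obtain ⟨ρ, hρ, hρc⟩ := Finset.exists_mem_ne (by omega : 1 < (forestRoots S q).card) c
    obtain ⟨hρS, hqρ⟩ := mem_forestRoots.1 hρ
    refine ⟨Function.update q c ρ, ?_, c, ρ, hc, hρS, hρc.symm, hqc, hqρ, hsc, rfl⟩
    rw [Finset.mem_filter, mem_rootedTrees]
    have hroots : forestRoots S (Function.update q c ρ) = (forestRoots S q).erase c := by
      ext v
      by_cases hv : v = c
      · simp [forestRoots, hv, hq.ne_bot hρS]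
      · simp [forestRoots, hv]
    refine ⟨⟨hq.link hc hρS hρc.symm hqρ, ?_⟩, ?_⟩
    · rw [hroots, Finset.card_erase_of_mem (mem_forestRoots.2 ⟨hc, hqc⟩), h2]
    · by_cases h : s = c
      · rw [h, Function.update_self]
        exact hq.ne_bot hρS
      · rw [Function.update_of_ne h]
        exact fun h' => h (hq.eq_of_reaches_of_root hsc h' (hq.ne_bot hc))
  · intro p hp
    rw [Finset.mem_filter, mem_rootedTrees] at hp
    obtain ⟨⟨hp, h1⟩, hps⟩ := hp
    obtain ⟨c, hc, hsc, hpc, hppc⟩ := hp.exists_child_of_root hps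
    have hpcS := hp.apply_mem c hc hpc
    have hne : p c ≠ c := fun h => hpc (h ▸ hppc)
    have hroots : forestRoots S (Function.update p c ⊥) = insert c (forestRoots S p) := by
      ext v
      by_cases hv : v = c
      · simp [forestRoots, hv, hc]
      · simp [forestRoots, hv]
    refine ⟨Function.update p c ⊥, ?_, c, p c, hc, hpcS, hne.symm, Function.update_self _ _ _,
      by rw [Function.update_of_ne hne, hppc], hsc.update ⊥, by simp⟩
    rw [Finset.mem_filter, mem_forests]
    refine ⟨hp.cut c, ?_⟩
    rw [hroots, Finset.card_insert_of_notMem (fun h => hpc (mem_forestRoots.1 h).2), h1]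
  · rintro q hq p p' ⟨c, ρ, hc, hρ, hcρ, hqc, hqρ, hsc, rfl⟩
      ⟨c', ρ', hc', hρ', hcρ', hqc', hqρ', hsc', rfl⟩
    rw [Finset.mem_filter, mem_forests] at hq
    obtain ⟨hq, h2⟩ := hq
    obtain rfl := hq.root_unique (hq.ne_bot hc) (hq.ne_bot hc') hqc hqc' hsc hsc'
    have h3 : ((forestRoots S q).erase c).card ≤ 1 := by
      rw [Finset.card_erase_of_mem (mem_forestRoots.2 ⟨hc, hqc⟩), h2]
    rw [Finset.card_le_one.1 h3 ρ (Finset.mem_erase.2 ⟨hcρ.symm, mem_forestRoots.2 ⟨hρ, hqρ⟩⟩)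
      ρ' (Finset.mem_erase.2 ⟨hcρ'.symm, mem_forestRoots.2 ⟨hρ', hqρ'⟩⟩)]
  · intro p hp q q'
    rw [Finset.mem_filter, mem_rootedTrees] at hp
    obtain ⟨⟨hp, -⟩, -⟩ := hp
    have key : ∀ {q : α → α} {c ρ : α}, c ≠ ρ → ρ ∈ S → q c = ⊥ → q ρ = ⊥ → Reaches q s c →
        p = Function.update q c ρ →
        Reaches p s c ∧ p c ≠ ⊥ ∧ p (p c) = ⊥ ∧ q = Function.update p c ⊥ := by
      rintro q c ρ hcρ hρ hqc hqρ hsc rfl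
      refine ⟨hsc.update ρ, ?_, ?_, ?_⟩
      · rw [Function.update_self]
        exact hp.ne_bot hρ
      · rw [Function.update_self, Function.update_of_ne hcρ.symm, hqρ]
      · rw [Function.update_idem, ← hqc, Function.update_eq_self]
    rintro ⟨c, ρ, -, hρ, hcρ, hqc, hqρ, hsc, hpq⟩ ⟨c', ρ', -, hρ', hcρ', hqc', hqρ', hsc', hpq'⟩
    obtain ⟨h1, h2, h3, h4⟩ := key hcρ hρ hqc hqρ hsc hpq
    obtain ⟨h1', h2', h3', h4'⟩ := key hcρ' hρ' hqc' hqρ' hsc' hpq'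
    rw [h4, h4', hp.child_of_root_unique h1 h1' h2 h3 h2' h3']
  · rintro q hq p - ⟨c, ρ, hc, hρ, hcρ, hqc, hqρ, hsc, rfl⟩
    rw [Finset.mem_filter, mem_forests] at hq
    rw [twistSet_link hq.1 hmin hc hρ hcρ hqc hqρ hsc]

theorem sum_rootedTrees_eq_add {S : Finset α} {s : α} (hS : ⊥ ∉ S) (hs : s ∈ S)
    (hmin : ∀ v ∈ S, s ≤ v) :
    ∑ p ∈ rootedTrees S, X ^ (twistSet p).card =
      ∑ q ∈ forests (S.erase s), (X : ℕ[X]) ^ (twistSet q).card +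
        X * ∑ A ∈ (S.erase s).powerset,
          (∑ q ∈ rootedTrees (insert s A), X ^ (twistSet q).card) *
            ∑ q ∈ rootedTrees (S.erase s \ A), X ^ (twistSet q).card := by
  rw [← Finset.sum_filter_add_sum_filter_not (rootedTrees S) (fun p => p s = ⊥),
    sum_rootedTrees_root_min hS hs hmin, sum_rootedTrees_root_ne_min hs hmin]
  have h := sum_forests_eq_sum_powerset hs (fun k => if k = 2 then (1 : ℕ[X]) else 0)
  simp only [mul_ite, mul_one, mul_zero, ← Finset.sum_filter] at h
  simp only [pow_succ', ← Finset.mul_sum]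
  rw [h]
  refine congrArg (_ + X * ·) (Finset.sum_congr rfl fun A _ => congrArg (_ * ·) ?_)
  refine Finset.sum_congr ?_ fun _ _ => rfl
  ext q
  simp only [rootedTrees, Finset.mem_filter]
  exact and_congr_right fun _ => by omega

theorem sum_forests_and_rootedTrees (S : Finset α) (hS : ⊥ ∉ S) :
    ∑ p ∈ rootedTrees S, X ^ (twistSet p).card = rootedTreePoly S.card ∧
      ∑ p ∈ forests S, X ^ (twistSet p).card = growthPoly S.card 1 0 := by
  induction hn : S.card using Nat.strong_induction_on generalizing S with
  | _ n ih =>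
    subst hn
    rcases S.eq_empty_or_nonempty with rfl | hne
    · have hf : forests (∅ : Finset α) = {fun _ => ⊥} := by
        ext p
        rw [mem_forests, Finset.mem_singleton]
        constructor
        · intro hp
          funext v
          exact hp.apply_of_notMem v (Finset.notMem_empty v)
        · rintro rfl
          exact ⟨fun _ _ => rfl, by simp, fun _ => 0, by simp⟩
      have ht : twistSet (fun _ : α => (⊥ : α)) = ∅ := by
        rw [Finset.eq_empty_iff_forall_notMem]
        exact fun v hv => apply_ne_bot_of_mem_twistSet hv rfl
      constructor
      · simp [rootedTrees, forestRoots, rootedTreePoly]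
      · simp [hf, ht, growthPoly]
    · obtain ⟨s, hs, hmin⟩ : ∃ s ∈ S, ∀ v ∈ S, s ≤ v :=
        ⟨S.min' hne, S.min'_mem hne, fun v hv => S.min'_le v hv⟩
      have hcard : (S.erase s).card + 1 = S.card := Finset.card_erase_add_one hs
      have hsub : ∀ A ∈ (S.erase s).powerset, (insert s A).card = A.card + 1 ∧
          insert s A ⊆ S ∧ S.erase s \ A ⊆ S ∧ (S.erase s \ A).card < S.card ∧
          A.card + (S.erase s \ A).card + 1 = S.card := by
        intro A hA
        rw [Finset.mem_powerset] at hA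
        have h1 := Finset.card_sdiff_add_card_eq_card hA
        refine ⟨Finset.card_insert_of_notMem fun h => Finset.notMem_erase s S (hA h),
          Finset.insert_subset hs (hA.trans (Finset.erase_subset _ _)),
          Finset.sdiff_subset.trans (Finset.erase_subset _ _), by omega, by omega⟩
      have hT : ∑ p ∈ rootedTrees S, X ^ (twistSet p).card = rootedTreePoly S.card := by
        rw [sum_rootedTrees_eq_add hS hs hmin,
          (ih _ (by omega) (S.erase s) (fun h => hS (Finset.mem_of_mem_erase h)) rfl).2,
          ← hcard, rootedTreePoly, growthPoly_succ_right _ 1 0]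
        refine congrArg (_ + X * ·) (Finset.sum_congr rfl fun A hA => ?_)
        obtain ⟨h1, h2, h3, h4, h5⟩ := hsub A hA
        rw [(ih _ h4 _ (fun h => hS (h3 h)) rfl).1]
        rcases Nat.eq_zero_or_pos (S.erase s \ A).card with h0 | h0
        · rw [h0, rootedTreePoly, mul_zero, mul_zero]
        · rw [(ih _ (by omega) (insert s A) (fun h => hS (h2 h)) rfl).1, h1, rootedTreePoly]
      refine ⟨hT, ?_⟩
      have h := sum_forests_eq_sum_powerset hs (fun _ => (1 : ℕ[X]))
      simp only [mul_one] at h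
      rw [h, ← hcard, growthPoly]
      simp only [Nat.cast_one, one_mul, Nat.cast_zero, zero_mul, add_zero]
      rw [growthPoly_add (S.erase s) 1 1 1 0]
      refine Finset.sum_congr rfl fun A hA => ?_
      obtain ⟨h1, h2, h3, h4, h5⟩ := hsub A hA
      rw [(ih _ h4 _ (fun h => hS (h3 h)) rfl).2]
      congr 1
      rcases Nat.lt_or_ge (insert s A).card S.card with h0 | h0
      · rw [(ih _ h0 (insert s A) (fun h => hS (h2 h)) rfl).1, h1, rootedTreePoly]
      · have e : insert s A = S := Finset.eq_of_subset_of_card_le h2 h0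
        rw [e, hT, ← e, h1, rootedTreePoly]

end Forests

section AddVertex

open Polynomial
open scoped Classical

/-- The graph obtained from `G` by adding a new largest vertex adjacent to the vertices in `L`. -/
def addVertex {k : ℕ} (G : SimpleGraph (Fin k)) (L : Finset (Fin k)) :
    SimpleGraph (Fin (k + 1)) where
  Adj u v := (∃ a b, G.Adj a b ∧ a.castSucc = u ∧ b.castSucc = v) ∨
    (∃ a ∈ L, u = Fin.last k ∧ a.castSucc = v) ∨ (∃ a ∈ L, v = Fin.last k ∧ a.castSucc = u)
  symm := ⟨by
    rintro u v (⟨a, b, h, h'⟩ | h | h)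
    · exact Or.inl ⟨b, a, h.symm, h'.symm⟩
    · exact Or.inr (Or.inr h)
    · exact Or.inr (Or.inl h)⟩
  loopless := ⟨by
    rintro u (⟨a, b, h, rfl, h'⟩ | ⟨a, -, rfl, h⟩ | ⟨a, -, rfl, h⟩)
    · exact h.ne (Fin.castSucc_injective k h').symm
    · exact Fin.castSucc_ne_last a h
    · exact Fin.castSucc_ne_last a h⟩

variable {k : ℕ} {G : SimpleGraph (Fin k)} {L : Finset (Fin k)} {a b : Fin k}

@[simp]
theorem addVertex_adj_castSucc :
    (addVertex G L).Adj a.castSucc b.castSucc ↔ G.Adj a b := by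
  simp [addVertex, Fin.castSucc_ne_last]

@[simp]
theorem addVertex_adj_last : (addVertex G L).Adj (Fin.last k) b.castSucc ↔ b ∈ L := by
  simp [addVertex, Fin.castSucc_ne_last]

/-- Graphs on `k + 1` vertices correspond to graphs on `k` vertices together with the set of
neighbors of the last vertex. -/
noncomputable def addVertexEquiv (k : ℕ) :
    SimpleGraph (Fin k) × Finset (Fin k) ≃ SimpleGraph (Fin (k + 1)) where
  toFun x := addVertex x.1 x.2
  invFun G := (G.comap Fin.castSucc, Finset.univ.filter fun a => G.Adj (Fin.last k) a.castSucc)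
  left_inv x := by
    ext <;> simp
  right_inv G := by
    ext u v
    induction u using Fin.lastCases with
    | last =>
      induction v using Fin.lastCases with
      | last => simp
      | cast b => simp
    | cast a =>
      induction v using Fin.lastCases with
      | last => rw [SimpleGraph.adj_comm, G.adj_comm]; simp
      | cast b => simp

/-- A set of at least one and at most two vertices that is a clique. -/
def IsSmallClique (G : SimpleGraph (Fin k)) (A : Set (Fin k)) : Prop :=
  A.Nonempty ∧ A.ncard ≤ 2 ∧ ∀ x ∈ A, ∀ y ∈ A, x ≠ y → G.Adj x y

theorem isSmallClique_addVertex {A : Set (Fin k)} :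
    IsSmallClique (addVertex G L) (Fin.castSucc '' A) ↔ IsSmallClique G A := by
  simp only [IsSmallClique, Set.image_nonempty,
    Set.ncard_image_of_injective _ (Fin.castSucc_injective k), Set.forall_mem_image,
    addVertex_adj_castSucc, ne_eq, Fin.castSucc_inj]

theorem lowerNbrs_addVertex_castSucc :
    lowerNbrs (addVertex G L) a.castSucc = Fin.castSucc '' lowerNbrs G a := by
  ext x
  induction x using Fin.lastCases with
  | last => simp [lowerNbrs, Fin.castSucc_ne_last, Fin.le_last]
  | cast b => simp [lowerNbrs]

theorem lowerNbrs_addVertex_last :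
    lowerNbrs (addVertex G L) (Fin.last k) = Fin.castSucc '' (L : Set (Fin k)) := by
  ext x
  induction x using Fin.lastCases with
  | last => simp [lowerNbrs, Fin.castSucc_ne_last]
  | cast b => simp [lowerNbrs, Fin.castSucc_lt_last]

theorem isIncreasing12Tree_addVertex (hk : 1 ≤ k) :
    IsIncreasing12Tree (addVertex G L) ↔ IsIncreasing12Tree G ∧ IsSmallClique G L := by
  change (∀ v : Fin (k + 1), 1 ≤ v.val → IsSmallClique _ (lowerNbrs (addVertex G L) v)) ↔
    (∀ v : Fin k, 1 ≤ v.val → IsSmallClique _ (lowerNbrs G v)) ∧ _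
  simp only [Fin.forall_fin_succ', lowerNbrs_addVertex_castSucc, lowerNbrs_addVertex_last,
    isSmallClique_addVertex, Fin.val_castSucc, Fin.val_last, hk, forall_const]

theorem ncard_edgeSet_addVertex :
    (addVertex G L).edgeSet.ncard = G.edgeSet.ncard + L.card := by
  have h : (addVertex G L).edgeSet = Sym2.map Fin.castSucc '' G.edgeSet ∪
      (fun a => s(Fin.last k, a.castSucc)) '' (L : Set (Fin k)) := by
    ext e
    induction e with | _ u v
    rw [SimpleGraph.mem_edgeSet]
    simp only [Set.mem_union, Set.mem_image, Sym2.exists, Sym2.map_mk, Sym2.eq_iff,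
      SimpleGraph.mem_edgeSet, addVertex, Finset.mem_coe]
    constructor
    · rintro (⟨a, b, h, h'⟩ | ⟨a, ha, h, h'⟩ | ⟨a, ha, h, h'⟩)
      · exact Or.inl ⟨a, b, h, Or.inl h'⟩
      · exact Or.inr ⟨a, ha, Or.inl ⟨h.symm, h'⟩⟩
      · exact Or.inr ⟨a, ha, Or.inr ⟨h.symm, h'⟩⟩
    · rintro (⟨a, b, h, h' | h'⟩ | ⟨a, ha, ⟨h, h'⟩ | ⟨h, h'⟩⟩)
      · exact Or.inl ⟨a, b, h, h'⟩
      · exact Or.inl ⟨b, a, h.symm, h'.symm⟩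
      · exact Or.inr (Or.inl ⟨a, ha, h.symm, h'⟩)
      · exact Or.inr (Or.inr ⟨a, ha, h.symm, h'⟩)
  rw [h, Set.ncard_union_eq, Set.ncard_image_of_injective _
    (Sym2.map.injective (Fin.castSucc_injective k)), Set.ncard_image_of_injective,
    Set.ncard_coe_finset]
  · intro a b h
    simpa [Sym2.eq_iff, Fin.castSucc_ne_last, (Fin.castSucc_ne_last _).symm] using h
  · rw [Set.disjoint_left]
    rintro _ ⟨e, -, rfl⟩ ⟨a, -, h⟩
    induction e with | _ u v
    simp [(Fin.castSucc_ne_last _).symm] at h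

theorem sum_isSmallClique {M : Type*} [AddCommMonoid M] (G : SimpleGraph (Fin k)) (h : ℕ → M) :
    ∑ L ∈ Finset.univ.filter fun L : Finset (Fin k) => IsSmallClique G L, h L.card =
      k • h 1 + G.edgeSet.ncard • h 2 := by
  have h1 : (Finset.univ.filter fun L : Finset (Fin k) => IsSmallClique G L) =
      Finset.univ.powersetCard 1 ∪ G.edgeFinset.image Sym2.toFinset := by
    ext L
    simp only [Finset.mem_filter, Finset.mem_univ, true_and, Finset.mem_union,
      Finset.mem_powersetCard_univ, Finset.mem_image, SimpleGraph.mem_edgeFinset, Sym2.exists,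
      SimpleGraph.mem_edgeSet, Sym2.toFinset_mk_eq]
    rw [IsSmallClique, Finset.coe_nonempty, Set.ncard_coe_finset, ← Finset.card_pos]
    constructor
    · rintro ⟨h0, h2, h⟩
      rcases (by omega : L.card = 1 ∨ L.card = 2) with hL | hL
      · exact Or.inl hL
      · obtain ⟨x, y, hxy, rfl⟩ := Finset.card_eq_two.1 hL
        exact Or.inr ⟨x, y, h x (by simp) y (by simp) hxy, rfl⟩
    · rintro (hL | ⟨x, y, hxy, rfl⟩)
      · refine ⟨by omega, by omega, fun x hx y hy hxy => (hxy ?_).elim⟩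
        exact Finset.card_le_one.1 hL.le x hx y hy
      · rw [Finset.card_pair hxy.ne]
        refine ⟨by omega, by omega, ?_⟩
        simp [hxy, hxy.symm]
  have hcard : ∀ e ∈ G.edgeFinset, e.toFinset.card = 2 := fun e he =>
    Sym2.card_toFinset_of_not_isDiag e (G.not_isDiag_of_mem_edgeSet (by simpa using he))
  rw [h1, Finset.sum_union, Finset.sum_image]
  · rw [Finset.sum_congr rfl fun L hL => congrArg h (Finset.mem_powersetCard.1 hL).2,
      Finset.sum_congr rfl fun e he => congrArg h (hcard e he)]
    rw [← SimpleGraph.coe_edgeFinset, Set.ncard_coe_finset]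
    simp
  · intro e _ e' _ h
    exact Sym2.ext fun x => by rw [← Sym2.mem_toFinset, ← Sym2.mem_toFinset, h]
  · rw [Finset.disjoint_left]
    intro L hL hL'
    obtain ⟨e, he, rfl⟩ := Finset.mem_image.1 hL'
    have := hcard e he
    rw [(Finset.mem_powersetCard.1 hL).2] at this
    omega

theorem sum_increasing12Trees_growthPoly (m n : ℕ) :
    ∑ G : SimpleGraph (Fin (m + 1)) with IsIncreasing12Tree G,
      (X : ℕ[X]) ^ G.edgeSet.ncard * growthPoly n (m + 1) G.edgeSet.ncard * X ^ n =
      X ^ (m + n) * growthPoly (m + n) 1 0 := by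
  induction m generalizing n with
  | zero =>
    have h : (Finset.univ.filter fun G : SimpleGraph (Fin (0 + 1)) => IsIncreasing12Tree G) =
        {⊥} := by
      ext G
      have : G = ⊥ := eq_bot_iff.2 fun u v h => (h.ne (Fin.ext (by omega))).elim
      simp only [this, Finset.mem_filter, Finset.mem_univ, true_and, Finset.mem_singleton,
        iff_true]
      intro v hv
      omega
    rw [h, Finset.sum_singleton]
    simp [mul_comm]
  | succ m ih =>
    rw [Nat.add_right_comm m 1 n, Nat.add_assoc m n 1, ← ih (n + 1), Finset.sum_filter,
      ← (addVertexEquiv (m + 1)).sum_comp, Fintype.sum_prod_type, Finset.sum_filter]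
    refine Finset.sum_congr rfl fun G _ => ?_
    simp only [addVertexEquiv, Equiv.coe_fn_mk, isIncreasing12Tree_addVertex (Nat.le_add_left 1 m),
      ncard_edgeSet_addVertex]
    by_cases hG : IsIncreasing12Tree G
    · simp only [hG, true_and, if_true]
      rw [← Finset.sum_filter, sum_isSmallClique G (fun c => (X : ℕ[X]) ^ (G.edgeSet.ncard + c) *
        growthPoly n (m + 1 + 1) (G.edgeSet.ncard + c) * X ^ n), growthPoly, nsmul_eq_mul,
        nsmul_eq_mul]
      ring
    · simp [hG]

theorem sum_increasing12Trees (m : ℕ) :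
    ∑ G : SimpleGraph (Fin (m + 1)) with IsIncreasing12Tree G, (X : ℕ[X]) ^ G.edgeSet.ncard =
      X ^ m * growthPoly m 1 0 := by
  simpa [growthPoly] using sum_increasing12Trees_growthPoly m 0

end AddVertex

section ParentGraph

/-- The graph joining every vertex to its image under the parent function `p`. -/
def parentGraph {α : Type*} (p : α → α) : SimpleGraph α := SimpleGraph.fromRel fun u v => p u = v

theorem parentGraph_adj {α : Type*} {p : α → α} {u v : α} :
    (parentGraph p).Adj u v ↔ u ≠ v ∧ (p u = v ∨ p v = u) := Iff.rfl

namespace IsForest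

variable {α : Type*} [LinearOrder α] [OrderBot α] [Fintype α] {p q : α → α} {u v w : α}

theorem apply_ne (hp : IsForest (Finset.univ.erase ⊥) p) (hv : v ≠ ⊥) : p v ≠ v := fun h =>
  hp.not_reaches_apply (by simpa using hv : v ∈ Finset.univ.erase ⊥) (h.symm ▸ Reaches.refl p v)

theorem edge_injective (hp : IsForest (Finset.univ.erase ⊥) p) (hv : v ≠ ⊥)
    (h : s(p v, v) = s(p w, w)) : v = w := by
  rw [Sym2.eq_iff] at h
  obtain ⟨-, h⟩ | ⟨h1, h2⟩ := h
  · exact h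
  · exact (hp.not_reaches_apply (by simpa using hv : v ∈ Finset.univ.erase ⊥)
      (h1.symm ▸ ⟨1, h2.symm⟩)).elim

theorem deleteEdges_adj (hp : IsForest (Finset.univ.erase ⊥) p) (hw : w ≠ ⊥) (hwv : w ≠ v) :
    ((parentGraph p).deleteEdges {s(p v, v)}).Adj w (p w) := by
  rw [SimpleGraph.deleteEdges_adj, parentGraph_adj]
  refine ⟨⟨(hp.apply_ne hw).symm, Or.inl rfl⟩, fun h => hwv (hp.edge_injective hw ?_)⟩
  rw [Sym2.eq_swap]
  exact h

theorem deleteEdges_reachable_iff (hp : IsForest (Finset.univ.erase ⊥) p) (hv : v ≠ ⊥) :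
    ((parentGraph p).deleteEdges {s(p v, v)}).Reachable v w ↔ Reaches p w v := by
  constructor
  · have key : ∀ a b, ((parentGraph p).deleteEdges {s(p v, v)}).Adj a b → p a = b →
        (Reaches p a v ↔ Reaches p b v) := by
      rintro a _ hab rfl
      refine ⟨fun h => h.eq_or_apply.resolve_left ?_, Reaches.head⟩
      rintro rfl
      exact (SimpleGraph.deleteEdges_adj.1 hab).2 (by simp [Sym2.eq_swap])
    rintro ⟨W⟩
    suffices h : Reaches p v v ↔ Reaches p w v from h.1 (Reaches.refl p v)
    generalize hx : v = x at W
    rw [← hx] at W ⊢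
    have : ∀ a b, ((parentGraph p).deleteEdges {s(p v, v)}).Walk a b →
        (Reaches p a v ↔ Reaches p b v) := by
      intro a b W
      induction W with
      | nil => exact Iff.rfl
      | cons h _ ih =>
        refine Iff.trans ?_ ih
        rcases (SimpleGraph.deleteEdges_adj.1 h).1.2 with h' | h'
        · exact key _ _ h h'
        · exact (key _ _ h.symm h').symm
    exact this _ _ W
  · rintro ⟨k, hk⟩
    induction k generalizing w with
    | zero => exact hk ▸ SimpleGraph.Reachable.refl _
    | succ k ih =>
      by_cases hwv : w = v
      · exact hwv ▸ SimpleGraph.Reachable.refl _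
      · have hw : w ≠ ⊥ := by
          rintro rfl
          exact hv (hp.eq_bot_of_reaches ⟨_, hk⟩)
        exact (ih hk).trans (hp.deleteEdges_adj hw hwv).symm.reachable

theorem deleteEdges_reachable_bot (hp : IsForest (Finset.univ.erase ⊥) p)
    (hwv : ¬ Reaches p w v) :
    ((parentGraph p).deleteEdges {s(p v, v)}).Reachable w ⊥ := by
  obtain ⟨k, hk⟩ := hp.reaches_bot w
  induction k generalizing w with
  | zero => exact hk ▸ SimpleGraph.Reachable.refl _
  | succ k ih =>
    by_cases hw : w = ⊥
    · exact hw ▸ SimpleGraph.Reachable.refl _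
    · refine (hp.deleteEdges_adj hw ?_).reachable.trans (ih (fun h => hwv h.head) hk)
      rintro rfl
      exact hwv (Reaches.refl p w)

theorem exists_of_adj (hp : IsForest (Finset.univ.erase ⊥) p) (h : (parentGraph p).Adj u v) :
    ∃ w ≠ ⊥, s(u, v) = s(p w, w) := by
  obtain ⟨hne, rfl | rfl⟩ := h
  · exact ⟨u, fun h => hne (by rw [h, hp.apply_bot]), Sym2.eq_swap⟩
  · exact ⟨v, fun h => hne (by rw [h, hp.apply_bot]), rfl⟩

theorem isTree_parentGraph (hp : IsForest (Finset.univ.erase ⊥) p) : (parentGraph p).IsTree := by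
  constructor
  · have h : ∀ w, (parentGraph p).Reachable w ⊥ := by
      intro w
      obtain ⟨k, hk⟩ := hp.reaches_bot w
      induction k generalizing w with
      | zero => exact hk ▸ SimpleGraph.Reachable.refl _
      | succ k ih =>
        by_cases hw : w = ⊥
        · exact hw ▸ SimpleGraph.Reachable.refl _
        · have : (parentGraph p).Adj w (p w) := ⟨(hp.apply_ne hw).symm, Or.inl rfl⟩
          exact this.reachable.trans (ih _ hk)
    exact ⟨fun u v => (h u).trans (h v).symm⟩
  · rw [SimpleGraph.isAcyclic_iff_forall_isBridge]
    intro e he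
    induction e with | _ u v
    obtain ⟨w, hw, h⟩ := hp.exists_of_adj he
    rw [h, SimpleGraph.isBridge_iff]
    intro h'
    rw [SimpleGraph.reachable_comm] at h'
    exact hp.not_reaches_apply (by simpa using hw : w ∈ Finset.univ.erase ⊥)
      ((hp.deleteEdges_reachable_iff hw).1 h')

theorem parentGraph_injective (hp : IsForest (Finset.univ.erase ⊥) p)
    (hq : IsForest (Finset.univ.erase ⊥) q) (h : parentGraph p = parentGraph q) : p = q := by
  obtain ⟨d, -, hd⟩ := hp.exists_rank
  funext v
  induction hk : d v using Nat.strong_induction_on generalizing v with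
  | _ k ih =>
    by_cases hv : v = ⊥
    · rw [hv, hp.apply_bot, hq.apply_bot]
    · have h1 : (parentGraph q).Adj v (p v) := h ▸ ⟨(hp.apply_ne hv).symm, Or.inl rfl⟩
      have hvS : v ∈ Finset.univ.erase (⊥ : α) := by simpa using hv
      rcases h1.2 with h2 | h2
      · exact h2.symm
      · exact (hp.not_reaches_apply hvS
          ⟨1, (ih _ (hk ▸ hd v hvS) (p v) rfl).trans h2⟩).elim

theorem exists_parentGraph_eq {T : SimpleGraph α} (hT : T.IsTree) :
    ∃ p, IsForest (Finset.univ.erase ⊥) p ∧ parentGraph p = T := by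
  have h : ∀ v : α, v ≠ ⊥ → ∃ u, T.Adj v u ∧ T.dist u ⊥ < T.dist v ⊥ := by
    intro v hv
    obtain ⟨W, hW⟩ := hT.1.exists_walk_length_eq_dist v ⊥
    cases W with
    | nil => exact (hv rfl).elim
    | cons h W =>
      refine ⟨_, h, ?_⟩
      rw [← hW, SimpleGraph.Walk.length_cons]
      exact Nat.lt_succ_of_le (SimpleGraph.dist_le W)
  choose! f hf using h
  have hp : IsForest (Finset.univ.erase ⊥) (Function.update f ⊥ ⊥) :=
    { apply_of_notMem := fun v hv => by
        have : v = ⊥ := by simpa using hv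
        rw [this, Function.update_self]
      apply_mem := fun v _ h => by simpa using h
      exists_rank := ⟨fun v => T.dist v ⊥, SimpleGraph.dist_self, fun v hv => by
        have hv : v ≠ ⊥ := by simpa using hv
        rw [Function.update_of_ne hv]
        exact (hf v hv).2⟩ }
  have hpT : parentGraph (Function.update f ⊥ ⊥) ≤ T := by
    have hle : ∀ u v, u ≠ v → Function.update f ⊥ ⊥ u = v → T.Adj u v := by
      intro u v huv h
      by_cases hu : u = ⊥
      · rw [hu, Function.update_self] at h
        exact (huv (hu.trans h)).elim
      · rw [Function.update_of_ne hu] at h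
        exact h ▸ (hf u hu).1
    rintro u v ⟨huv, h | h⟩
    · exact hle u v huv h
    · exact (hle v u huv.symm h).symm
  exact ⟨_, hp, hpT.antisymm
    ((SimpleGraph.isTree_iff_minimal_connected.1 hT).2 hp.isTree_parentGraph.1 hpT)⟩

end IsForest

namespace IsForest

variable {m : ℕ} {p : Fin (m + 1) → Fin (m + 1)} {u v : Fin (m + 1)}

theorem isChild_iff (hp : IsForest (Finset.univ.erase ⊥) p) :
    IsChild (parentGraph p) ⊥ u v ↔ v ≠ ⊥ ∧ p v = u := by
  constructor
  · rintro ⟨⟨huv, rfl | rfl⟩, h⟩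
    · have hu : u ≠ ⊥ := fun hu => huv (by rw [hu, hp.apply_bot])
      rw [Sym2.eq_swap] at h
      exact (h (hp.deleteEdges_reachable_bot (hp.not_reaches_apply
        (by simpa using hu : u ∈ Finset.univ.erase ⊥))).symm).elim
    · exact ⟨fun hv => huv (by rw [hv, hp.apply_bot]), rfl⟩
  · rintro ⟨hv, rfl⟩
    refine ⟨⟨hp.apply_ne hv, Or.inr rfl⟩, fun h => hv ?_⟩
    exact hp.eq_bot_of_reaches ((hp.deleteEdges_reachable_iff hv).1 h.symm)

theorem subtreeSet_eq (hp : IsForest (Finset.univ.erase ⊥) p) (hv : v ≠ ⊥) :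
    subtreeSet (parentGraph p) (p v) v = {w | Reaches p w v} :=
  Set.ext fun _ => hp.deleteEdges_reachable_iff hv

theorem isTwist_iff (hp : IsForest (Finset.univ.erase ⊥) p) {e : Sym2 (Fin (m + 1))} :
    IsTwist (parentGraph p) ⊥ e ↔ ∃ v ∈ twistSet p, e = s(p v, v) := by
  have key : ∀ v ≠ ⊥, minLabel (subtreeSet (parentGraph p) (p v) v) < (p v).val ↔
      v ∈ twistSet p := by
    intro v hv
    rw [hp.subtreeSet_eq hv, mem_twistSet, minLabel,
      csInf_lt_iff (OrderBot.bddBelow _) (Set.Nonempty.image _ ⟨v, Reaches.refl p v⟩)]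
    simp only [Set.mem_image, Set.mem_ofPred_eq, exists_exists_and_eq_and, Fin.val_fin_lt]
  constructor
  · rintro ⟨u, v, rfl, h, h'⟩
    obtain ⟨hv, rfl⟩ := hp.isChild_iff.1 h
    exact ⟨v, (key v hv).1 h', rfl⟩
  · rintro ⟨v, hv, rfl⟩
    have hv' : v ≠ ⊥ := fun h => apply_ne_bot_of_mem_twistSet hv (by rw [h, hp.apply_bot])
    exact ⟨_, v, rfl, hp.isChild_iff.2 ⟨hv', rfl⟩, (key v hv').2 hv⟩

theorem isIncreasingEdge_of_apply_eq_bot (hp : IsForest (Finset.univ.erase ⊥) p) (hv : v ≠ ⊥)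
    (h : p v = ⊥) : IsIncreasingEdge (parentGraph p) ⊥ s(⊥, v) := by
  refine ⟨⊥, v, rfl, hp.isChild_iff.2 ⟨hv, h⟩, ?_⟩
  rw [← h, hp.subtreeSet_eq hv, h]
  have hne : (Fin.val '' {w | Reaches p w v}).Nonempty := ⟨_, v, Reaches.refl p v, rfl⟩
  obtain ⟨w, hw, hw'⟩ := Nat.sInf_mem hne
  rw [minLabel, ← hw', Fin.val_fin_lt, bot_lt_iff_ne_bot]
  rintro rfl
  exact hv (hp.eq_bot_of_reaches hw)

theorem numTwists_eq (hp : IsForest (Finset.univ.erase ⊥) p) :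
    numTwists (parentGraph p) ⊥ = (twistSet p).card := by
  have hne : ∀ v ∈ twistSet p, v ≠ ⊥ := fun v hv h =>
    apply_ne_bot_of_mem_twistSet hv (by rw [h, hp.apply_bot])
  have h : {e | e ∈ (parentGraph p).edgeSet ∧ IsTwist (parentGraph p) ⊥ e} =
      ((twistSet p).image fun v => s(p v, v) : Finset _) := by
    ext e
    rw [Finset.mem_coe, Finset.mem_image, Set.mem_ofPred_eq, hp.isTwist_iff]
    constructor
    · rintro ⟨-, v, hv, rfl⟩
      exact ⟨v, hv, rfl⟩
    · rintro ⟨v, hv, rfl⟩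
      exact ⟨⟨hp.apply_ne (hne v hv), Or.inr rfl⟩, v, hv, rfl⟩
  rw [numTwists, ← Finset.card_image_of_injOn fun v hv w _ h => hp.edge_injective (hne v hv) h,
    ← Set.ncard_coe_finset, ← h]
  rfl

end IsForest

end ParentGraph

section Bijection

open Polynomial
open scoped Classical

theorem card_filter_eq_of_sum_X_pow_eq {α β : Type*} {s : Finset α} {t : Finset β} {f : α → ℕ}
    {g : β → ℕ} (h : ∑ a ∈ s, (X : ℕ[X]) ^ f a = ∑ b ∈ t, X ^ g b) (c : ℕ) :
    (s.filter fun a => f a = c).card = (t.filter fun b => g b = c).card := by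
  have := congrArg (coeff · c) h
  simpa [finsetSum_coeff, coeff_X_pow, Finset.sum_boole, eq_comm] using this

/-- Two subtypes carrying statistics with equinumerous fibers are in bijection; if one fiber of
the first is contained in the corresponding fiber of the second, the bijection can be chosen to
be the identity there. -/
theorem exists_equiv_of_card_fibers {α : Type*} [Finite α] {P Q : α → Prop} {f g : α → ℕ}
    (h : ∀ c, Nat.card {x : {x // P x} // f x = c} = Nat.card {x : {x // Q x} // g x = c})
    (c₀ : ℕ) (h₀ : ∀ x, P x → f x = c₀ → Q x ∧ g x = c₀) :
    ∃ φ : {x // P x} ≃ {x // Q x}, ∀ x, g (φ x) = f x ∧ (f x = c₀ → (φ x).1 = x.1) := by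
  have key : ∀ c, ∃ e : {x : {x // P x} // f x = c} ≃ {x : {x // Q x} // g x = c},
      c = c₀ → ∀ x, (e x).1.1 = x.1.1 := by
    intro c
    by_cases hc : c = c₀
    · subst hc
      let i : {x : {x // P x} // f x = c} → {x : {x // Q x} // g x = c} := fun x =>
        ⟨⟨x.1.1, (h₀ _ x.1.2 x.2).1⟩, (h₀ _ x.1.2 x.2).2⟩
      have hi : Function.Injective i := fun x y hxy =>
        Subtype.ext (Subtype.ext (congrArg (fun z => z.1.1) hxy))
      exact ⟨Equiv.ofBijective i (hi.bijective_of_nat_card_le (h c).ge), fun _ _ => rfl⟩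
    · exact ⟨(Finite.card_eq.1 (h c)).some, fun h => (hc h).elim⟩
  choose e he using key
  refine ⟨Equiv.ofFiberEquiv (f := fun x : {x // P x} => f x) (g := fun x : {x // Q x} => g x) e,
    fun x => ⟨Equiv.ofFiberEquiv_map (f := fun x : {x // P x} => f x)
      (g := fun x : {x // Q x} => g x) e x, fun hx => ?_⟩⟩
  exact he (f x) hx ⟨x, rfl⟩

theorem sum_trees (m : ℕ) :
    ∑ T : SimpleGraph (Fin (m + 1)) with T.IsTree, (X : ℕ[X]) ^ numTwists T ⊥ =
      growthPoly m 1 0 := by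
  have h := (sum_forests_and_rootedTrees (Finset.univ.erase (⊥ : Fin (m + 1)))
    (Finset.notMem_erase _ _)).2
  rw [Finset.card_erase_of_mem (Finset.mem_univ _), Finset.card_univ, Fintype.card_fin,
    Nat.add_sub_cancel] at h
  rw [← h]
  symm
  refine Finset.sum_bij (fun p _ => parentGraph p) (fun p hp => ?_) (fun p hp q hq => ?_)
    (fun T hT => ?_) fun p hp => ?_
  · exact Finset.mem_filter.2 ⟨Finset.mem_univ _, (mem_forests.1 hp).isTree_parentGraph⟩
  · exact (mem_forests.1 hp).parentGraph_injective (mem_forests.1 hq)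
  · obtain ⟨p, hp, h⟩ := IsForest.exists_parentGraph_eq (Finset.mem_filter.1 hT).2
    exact ⟨p, mem_forests.2 hp, h⟩
  · rw [(mem_forests.1 hp).numTwists_eq]

theorem IsIncreasing12Tree.isTree_and_numTwists_eq_zero {m : ℕ} {G : SimpleGraph (Fin (m + 1))}
    (hG : IsIncreasing12Tree G) (h : G.edgeSet.ncard = m) : G.IsTree ∧ numTwists G ⊥ = 0 := by
  have hlow : ∀ v : Fin (m + 1), v ≠ ⊥ → ∃ u, G.Adj v u ∧ u < v := fun v hv =>
    (hG v (Nat.one_le_iff_ne_zero.2 fun h => hv (Fin.ext h))).1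
  choose! f hf using hlow
  have hfv : ∀ v, v ≠ ⊥ → Function.update f ⊥ ⊥ v = f v := fun v hv =>
    Function.update_of_ne hv _ _
  generalize hpf : Function.update f ⊥ ⊥ = p at hfv
  have hbot : p ⊥ = ⊥ := by rw [← hpf, Function.update_self]
  have hp : IsForest (Finset.univ.erase ⊥) p :=
    { apply_of_notMem := fun v hv => by
        have : v = ⊥ := by simpa using hv
        rw [this, hbot]
      apply_mem := fun v _ h => by simpa using h
      exists_rank := ⟨fun v => v.val, rfl, fun v hv => by
        have hv : v ≠ ⊥ := by simpa using hv
        rw [hfv v hv]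
        exact (hf v hv).2⟩ }
  have hle : parentGraph p ≤ G := by
    have hadj : ∀ u v, u ≠ v → p u = v → G.Adj u v := by
      rintro u _ huv rfl
      have hu : u ≠ ⊥ := fun hu => huv (by rw [hu, hbot])
      exact hfv u hu ▸ (hf u hu).1
    rintro u v ⟨huv, h | h⟩
    · exact hadj u v huv h
    · exact (hadj v u huv.symm h).symm
  have hcard := (SimpleGraph.isTree_iff_connected_and_card.1 hp.isTree_parentGraph).2
  rw [Nat.card_coe_set_eq, Nat.card_fin] at hcard
  have hpG : parentGraph p = G := SimpleGraph.edgeSet_injective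
    (Set.eq_of_subset_of_ncard_le (SimpleGraph.edgeSet_mono hle) (by omega))
  have hple : ∀ v, p v ≤ v := by
    intro v
    by_cases hv : v = ⊥
    · rw [hv, hbot]
    · exact hfv v hv ▸ (hf v hv).2.le
  refine ⟨hpG ▸ hp.isTree_parentGraph, ?_⟩
  rw [← hpG, hp.numTwists_eq, Finset.card_eq_zero, Finset.eq_empty_iff_forall_notMem]
  intro v hv
  obtain ⟨w, ⟨k, rfl⟩, hlt⟩ := mem_twistSet.1 hv
  exact lt_irrefl w (hlt.trans_le
    ((hple _).trans (Function.iterate_le_id_of_le_id hple k w)))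

theorem IsForest.of_card_twistSet {m : ℕ} {p : Fin (m + 1) → Fin (m + 1)}
    (hp : IsForest (Finset.univ.erase ⊥) p) (h : (twistSet p).card + 1 = m) :
    ((parentGraph p).neighborSet ⊥).ncard = 1 ∧ ∀ v ≠ ⊥, p v ≠ ⊥ → v ∈ twistSet p := by
  have hR : (parentGraph p).neighborSet ⊥ = forestRoots (Finset.univ.erase ⊥) p := by
    ext v
    simp only [SimpleGraph.mem_neighborSet, parentGraph_adj, hp.apply_bot, Finset.mem_coe,
      mem_forestRoots, Finset.mem_erase, Finset.mem_univ, and_true, ne_comm (a := v)]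
    exact and_congr_right fun hv => or_iff_right hv
  rw [hR, Set.ncard_coe_finset]
  have hne : (Fin.last m) ∈ Finset.univ.erase (⊥ : Fin (m + 1)) := by
    have : Fin.last m ≠ ⊥ := fun h0 => by
      have : m = 0 := congrArg Fin.val h0
      omega
    simpa using this
  obtain ⟨u, hu, hpu, -⟩ := hp.exists_root hne
  have hpos : 0 < (forestRoots (Finset.univ.erase ⊥) p).card :=
    Finset.card_pos.2 ⟨u, mem_forestRoots.2 ⟨hu, hpu⟩⟩
  have hsub : twistSet p ⊆ Finset.univ.erase ⊥ \ forestRoots (Finset.univ.erase ⊥) p := by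
    intro v hv
    have hv' := apply_ne_bot_of_mem_twistSet hv
    exact Finset.mem_sdiff.2 ⟨hp.mem_of_apply_ne_bot hv', fun h => hv' (mem_forestRoots.1 h).2⟩
  have hsub' : forestRoots (Finset.univ.erase ⊥) p ⊆ Finset.univ.erase ⊥ :=
    Finset.filter_subset _ _
  have hcard := Finset.card_sdiff_add_card_eq_card hsub'
  rw [Finset.card_erase_of_mem (Finset.mem_univ _), Finset.card_univ, Fintype.card_fin,
    Nat.add_sub_cancel] at hcard
  have hle := Finset.card_le_card hsub
  refine ⟨by omega, fun v hv hpv => ?_⟩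
  rw [Finset.eq_of_subset_of_card_le hsub (by omega), Finset.mem_sdiff, mem_forestRoots]
  exact ⟨by simpa using hv, fun h => hpv h.2⟩

theorem exists_equiv_increasing12Trees_trees (m : ℕ) :
    ∃ φ : {G : SimpleGraph (Fin (m + 1)) // IsIncreasing12Tree G} ≃
        {G : SimpleGraph (Fin (m + 1)) // G.IsTree},
      ∀ G, m + numTwists (φ G).1 ⊥ = G.1.edgeSet.ncard ∧
        (G.1.edgeSet.ncard = m → (φ G).1 = G.1) := by
  refine exists_equiv_of_card_fibers (f := fun G => G.edgeSet.ncard)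
    (g := fun T => m + numTwists T ⊥) (fun c => ?_) m fun G hG h => ?_
  · have hsum : ∑ G : SimpleGraph (Fin (m + 1)) with IsIncreasing12Tree G,
        (X : ℕ[X]) ^ G.edgeSet.ncard =
        ∑ T : SimpleGraph (Fin (m + 1)) with T.IsTree, X ^ (m + numTwists T ⊥) := by
      simp only [pow_add, ← Finset.mul_sum]
      rw [sum_increasing12Trees, sum_trees]
    have hc := card_filter_eq_of_sum_X_pow_eq hsum c
    rw [Finset.filter_filter, Finset.filter_filter, ← Fintype.card_subtype,
      ← Fintype.card_subtype, ← Nat.card_eq_fintype_card, ← Nat.card_eq_fintype_card] at hc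
    exact (Nat.card_congr (Equiv.subtypeSubtypeEquivSubtypeInter IsIncreasing12Tree
      fun G => G.edgeSet.ncard = c)).trans (hc.trans (Nat.card_congr
        (Equiv.subtypeSubtypeEquivSubtypeInter SimpleGraph.IsTree
          fun T => m + numTwists T ⊥ = c)).symm)
  · obtain ⟨h1, h2⟩ := hG.isTree_and_numTwists_eq_zero h
    exact ⟨h1, by rw [h2, add_zero]⟩

end Bijection

/-- For every `n ≥ 1` there is a bijection `φ` from increasing 1,2-trees on `{1,…,n}` to
Cayley trees on `{1,…,n}` such that (i) the number of edges of `G` is `(n-1)` plus the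
number of twists of `φ(G)`; (ii) if `G` is a tree then `φ(G) = G`; (iii) if `n ≥ 2` and `G`
has `2n-3` edges then the vertex with label 1 is incident to exactly one edge of `φ(G)`,
that edge is increasing, and every other edge of `φ(G)` is a twist. -/
theorem exists_bijection_increasing12Trees_cayleyTrees (n : ℕ) (hn : 1 ≤ n) :
    ∃ φ : {G : SimpleGraph (Fin n) // IsIncreasing12Tree G} ≃
          {G : SimpleGraph (Fin n) // G.IsTree},
      ∀ G : {G : SimpleGraph (Fin n) // IsIncreasing12Tree G},
        (G.1.edgeSet.ncard = (n - 1) + numTwists (φ G).1 ⟨0, hn⟩) ∧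
        (G.1.edgeSet.ncard = n - 1 → (φ G).1 = G.1) ∧
        (2 ≤ n → G.1.edgeSet.ncard = 2 * n - 3 →
          ((φ G).1.neighborSet ⟨0, hn⟩).ncard = 1 ∧
          (∀ e ∈ (φ G).1.edgeSet, (⟨0, hn⟩ : Fin n) ∈ e →
            IsIncreasingEdge (φ G).1 ⟨0, hn⟩ e) ∧
          (∀ e ∈ (φ G).1.edgeSet, (⟨0, hn⟩ : Fin n) ∉ e →
            IsTwist (φ G).1 ⟨0, hn⟩ e)) := by
  obtain ⟨m, rfl⟩ := Nat.exists_eq_add_of_le' hn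
  obtain ⟨φ, hφ⟩ := exists_equiv_increasing12Trees_trees m
  refine ⟨φ, fun G => ?_⟩
  obtain ⟨h1, h2⟩ := hφ G
  obtain ⟨p, hp, hpG⟩ := IsForest.exists_parentGraph_eq (φ G).2
  change _ = m + 1 - 1 + numTwists _ ⊥ ∧ _
  refine ⟨by rw [← h1, Nat.add_sub_cancel], fun h => h2 (by omega), fun hm h => ?_⟩
  rw [← hpG] at h1 ⊢
  rw [hp.numTwists_eq] at h1
  obtain ⟨hcard, htwist⟩ := hp.of_card_twistSet (by omega)
  refine ⟨hcard, fun e he hbot => ?_, fun e he hbot => ?_⟩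
  · obtain ⟨v, rfl⟩ := hbot
    obtain ⟨hv, h | h⟩ := (parentGraph p).mem_edgeSet.1 he
    · exact (hv (h.symm.trans hp.apply_bot).symm).elim
    · exact hp.isIncreasingEdge_of_apply_eq_bot hv.symm h
  · induction e with | _ u v
    obtain ⟨w, hw, h⟩ := hp.exists_of_adj he
    rw [h] at hbot ⊢
    exact hp.isTwist_iff.2 ⟨w, htwist w hw fun h' => hbot (h' ▸ Sym2.mem_mk_left _ _), rfl⟩
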